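/- arXiv:1707.09544 — 2 statements merged into one kernel-verified Lean document; each statement's English description precedes it below -/
import Mathlib

section
/- For every relational language Θ with ⊏ ∉ Θ, the category ERst_srq(Θ, ⊏), whose objects are all finite reflexive Θ-structures with linear extensions (Θ-ersts) and whose morphisms are strong rigid quotient maps, has the dual Ramsey property. -/
open scoped Classical

noncomputable section

/-! ### Basic notions: anti-lexicographic order, types, matrices,
special anti-lexicographic order, rigid surjections -/

/-- `altLex X Y` : the anti-lexicographic order `⊏_alex` on subsets of a chain,
comparing characteristic vectors anti-lexicographically (`0 < 1`), i.e. the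
`⊏`-largest element on which `X` and `Y` differ belongs to `Y`. -/
def altLex {A : Type*} [LinearOrder A] (X Y : Finset A) : Prop :=
  ∃ m, m ∈ Y ∧ m ∉ X ∧ ∀ z, m < z → (z ∈ X ↔ z ∈ Y)

/-- The `≡_σ`-equivalence class of `i` within `{0, …, n-1}`, for a
(total quasi)order `σ` on `{0, …, n-1}`. -/
def classOf (σ : ℕ → ℕ → Prop) (n i : ℕ) : Finset ℕ :=
  (Finset.range n).filter fun j => σ i j ∧ σ j i

/-- The set of `≡_σ`-equivalence classes. -/
def classesOf (σ : ℕ → ℕ → Prop) (n : ℕ) : Finset (Finset ℕ) :=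
  (Finset.range n).image (classOf σ n)

/-- `σ ◁ τ` : the linear order on total quasiorders on `{0, …, n-1}` : `σ ◁ τ` if `σ`
has fewer classes, or they have equally many classes and the tuples of classes, each
listed in `<_alex`-increasing order, compare anti-lexicographically w.r.t. `<_alex`
(for such increasing enumerations of two families of sets this amounts to: the
`<_alex`-largest class in which the two families differ belongs to the family of
classes of `τ`). -/
def quasiLT (n : ℕ) (σ τ : ℕ → ℕ → Prop) : Prop :=
  (classesOf σ n).card < (classesOf τ n).card ∨
    ((classesOf σ n).card = (classesOf τ n).card ∧
      ∃ M, M ∈ classesOf τ n ∧ M ∉ classesOf σ n ∧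
        ∀ X, altLex M X → (X ∈ classesOf σ n ↔ X ∈ classesOf τ n))

/-- `IsTotalQuasiorder n σ` : `σ` is a total quasiorder on `{0, …, n-1}`. -/
def IsTotalQuasiorder (n : ℕ) (σ : ℕ → ℕ → Prop) : Prop :=
  (∀ i j, σ i j → i < n ∧ j < n) ∧ (∀ i < n, σ i i) ∧
    (∀ i j k, σ i j → σ j k → σ i k) ∧ ∀ i j, i < n → j < n → σ i j ∨ σ j i

/-- The type `tp(ā)` of a tuple (represented as a list): the total quasiorder
`{(i,j) : a_i ⊑ a_j}` on the set of positions of the list. -/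
def tpRel {A : Type*} [LinearOrder A] (l : List A) : ℕ → ℕ → Prop :=
  fun i j => ∃ (hi : i < l.length) (hj : j < l.length), l.get ⟨i, hi⟩ ≤ l.get ⟨j, hj⟩

/-- The special anti-lexicographic order `⊏_sal` on tuples (represented as lists):
`ā ⊏_sal b̄` iff `tp(ā) ◁ tp(b̄)`, or the types coincide, the sets of entries
differ and the set of entries of `ā` is `⊏_alex`-below that of `b̄`. -/
def salLT {A : Type*} [LinearOrder A] (l₁ l₂ : List A) : Prop :=
  l₁.length = l₂.length ∧
    (quasiLT l₁.length (tpRel l₁) (tpRel l₂) ∨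
      (tpRel l₁ = tpRel l₂ ∧ l₁.toFinset ≠ l₂.toFinset ∧ altLex l₁.toFinset l₂.toFinset))

/-- The matrix `mat(ā)` of a tuple: the `⊏`-increasing enumeration of its set of
entries (one representative from each `≡_{tp(ā)}`-class, in increasing order). -/
def matL {A : Type*} [LinearOrder A] (l : List A) : List A :=
  l.toFinset.sort (· ≤ ·)

/-- The number of `≡_σ`-classes strictly `≺_σ`-below the class of `i`. -/
def classRank (σ : ℕ → ℕ → Prop) (n i : ℕ) : ℕ :=
  (((Finset.range n).filter fun j => σ j i ∧ ¬ σ i j).image (classOf σ n)).card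

/-- `tup σ n b` : the `n`-tuple obtained by placing the `ξ`-th entry of `b` on all
coordinates belonging to the `ξ`-th `≡_σ`-class (classes enumerated in the
`≺_σ`-increasing order). -/
def tup {A : Type*} [Nonempty A] (σ : ℕ → ℕ → Prop) (n : ℕ) (b : List A) : List A :=
  (List.range n).map fun i => b.getD (classRank σ n i) (Classical.arbitrary A)

/-- `m` is the minimum of `S` with respect to a strict order `lt`. -/
def MinWrt {α : Type*} (lt : α → α → Prop) (S : Set α) (m : α) : Prop :=
  m ∈ S ∧ ∀ x ∈ S, x = m ∨ lt m x

/-- `f` maps `S` onto `T` and is rigid w.r.t. the strict orders `ltA`, `ltB`: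
minima of preimages of `ltB`-comparable elements are `ltA`-comparable in the
same order. -/
def IsRigidSurjOn {α β : Type*} (ltA : α → α → Prop) (ltB : β → β → Prop)
    (S : Set α) (T : Set β) (f : α → β) : Prop :=
  (∀ a ∈ S, f a ∈ T) ∧ (∀ b ∈ T, ∃ a ∈ S, f a = b) ∧
    ∀ x ∈ T, ∀ y ∈ T, ltB x y → ∀ a b, MinWrt ltA {u | u ∈ S ∧ f u = x} a →
      MinWrt ltA {u | u ∈ S ∧ f u = y} b → ltA a b

/-- A rigid surjection between chains: a surjection such that
`min f⁻¹(x) ⊏ min f⁻¹(y)` whenever `x ⊏' y`. -/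
def IsRigidSurjection {A B : Type*} [LinearOrder A] [LinearOrder B] (f : A → B) : Prop :=
  Function.Surjective f ∧ ∀ x y : B, x < y → ∀ a b : A,
    IsLeast {u | f u = x} a → IsLeast {v | f v = y} b → a < b

/-! ### The dual Ramsey property for a class of objects with
designated surjective morphisms.

`C ⟶ (B)^A_k` in `C^op` unfolds to: for every `k`-colouring `χ` of the
morphisms `C → A` there are `w : C → B` and a colour `i` such that
`χ(g ∘ w) = i` for every morphism `g : B → A`.  -/

/-- The dual Ramsey property for the (full) subcategory spanned by `S` of the category
whose objects are `Obj` and whose morphisms `X → Y` are the functions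
`carrier X → carrier Y` satisfying `IsMor X Y`. -/
def HasDualRamseySub {Obj : Type*} (carrier : Obj → Type*)
    (IsMor : ∀ X Y : Obj, (carrier X → carrier Y) → Prop) (S : Set Obj) : Prop :=
  ∀ k : ℕ, 2 ≤ k → ∀ A ∈ S, ∀ B ∈ S, (∃ f : carrier B → carrier A, IsMor B A f) →
    ∃ C ∈ S, ∀ χ : (carrier C → carrier A) → Fin k,
      ∃ w : carrier C → carrier B, IsMor C B w ∧ ∃ i : Fin k,
        ∀ g : carrier B → carrier A, IsMor B A g → χ (g ∘ w) = i

/-- The dual Ramsey property for the category whose objects are `Obj` and whose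
morphisms `X → Y` are the functions `carrier X → carrier Y` satisfying `IsMor X Y`. -/
def HasDualRamseyClass {Obj : Type*} (carrier : Obj → Type*)
    (IsMor : ∀ X Y : Obj, (carrier X → carrier Y) → Prop) : Prop :=
  HasDualRamseySub carrier IsMor Set.univ

end

noncomputable section

/-- A finite `Θ`-erst: a reflexive `Θ`-structure with a linear extension, for the
relational language with symbols `Θ` and arities `ar` (with `⊏ ∉ Θ`); a `θ`-tuple is
represented as a list of length `ar θ`. Each relation contains all constant tuples
and each of its non-constant tuples is strictly `⊏`-increasing. -/
structure ThetaErst (Θ : Type*) (ar : Θ → ℕ) where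
  carrier : Type
  [fintypeI : Fintype carrier]
  [linearOrderI : LinearOrder carrier]
  rel : Θ → Set (List carrier)
  len : ∀ θ : Θ, ∀ l ∈ rel θ, l.length = ar θ
  refl : ∀ θ : Θ, ∀ a : carrier, List.replicate (ar θ) a ∈ rel θ
  ext : ∀ θ : Θ, ∀ l ∈ rel θ,
    (∃ a, l = List.replicate (ar θ) a) ∨ l.Chain' (· < ·)

attribute [instance] ThetaErst.fintypeI ThetaErst.linearOrderI

/-- Strong rigid quotient maps of `Θ`-ersts: homomorphisms `f` such that for every
`θ ∈ Θ` the coordinatewise extension `f̂ : (θ^A,⊏_sal) → (θ^B,⊏_sal)` is a rigid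
surjection. The morphisms of `ERst_srq(Θ,⊏)`. -/
def IsSRQtheta {Θ : Type*} {ar : Θ → ℕ} (M N : ThetaErst Θ ar)
    (f : M.carrier → N.carrier) : Prop :=
  ∀ θ : Θ, (∀ l ∈ M.rel θ, l.map f ∈ N.rel θ) ∧
    IsRigidSurjOn salLT salLT (M.rel θ) (N.rel θ) (List.map f)

/-- `IsParamWord t w k`: `w` is a word over the letters `0, …, t - 1` and the parameters
`t, …, t + k - 1` in which every parameter occurs and the first occurrences of the
parameters appear in increasing order. -/
inductive IsParamWord : ℕ → List ℕ → ℕ → Prop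
  | nil (t : ℕ) : IsParamWord t [] 0
  | letter {t a k : ℕ} {w : List ℕ} : a < t → IsParamWord t w k → IsParamWord t (a :: w) k
  | param {t k : ℕ} {w : List ℕ} : IsParamWord (t + 1) w k → IsParamWord t (t :: w) (k + 1)

/-- Substitution of the entries of `g` for the parameters `t, t + 1, …`. -/
def wordSubst (t : ℕ) (g : List ℕ) (x : ℕ) : ℕ :=
  if x < t then x else g.getD (x - t) x

/-- The longest initial segment of a word consisting of letters. -/
def letterPrefix (t : ℕ) (w : List ℕ) : List ℕ :=
  w.takeWhile (· < t)

theorem wordSubst_of_lt {t x : ℕ} (g : List ℕ) (h : x < t) : wordSubst t g x = x := by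
  simp [wordSubst, h]

theorem wordSubst_of_ge {t x : ℕ} {g : List ℕ} (h : t + g.length ≤ x) : wordSubst t g x = x := by
  have : ¬ x < t := by omega
  simp only [wordSubst, this, if_false]
  exact List.getD_eq_default _ _ (by omega)

theorem wordSubst_add {t i : ℕ} {g : List ℕ} (h : i < g.length) :
    wordSubst t g (t + i) = g[i] := by
  simp [wordSubst, h]

theorem wordSubst_cons_self (t : ℕ) (g : List ℕ) :
    wordSubst t (t :: g) = wordSubst (t + 1) g := by
  funext x
  unfold wordSubst
  rcases lt_trichotomy x t with h | rfl | h
  · simp [h, Nat.lt_succ_of_lt h]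
  · simp
  · obtain ⟨d, rfl⟩ : ∃ d, x = t + 1 + d := ⟨x - (t + 1), by omega⟩
    have h1 : ¬ t + 1 + d < t := by omega
    have h2 : ¬ t + 1 + d < t + 1 := by omega
    have h3 : t + 1 + d - t = d + 1 := by omega
    have h4 : t + 1 + d - (t + 1) = d := by omega
    rw [if_neg h1, if_neg h2, h3, h4, List.getD_cons_succ]

namespace IsParamWord

theorem mem_lt {t k : ℕ} {w : List ℕ} (h : IsParamWord t w k) : ∀ x ∈ w, x < t + k := by
  induction h with
  | nil => simp
  | letter ha _ ih =>
    intro x hx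
    rcases List.mem_cons.1 hx with rfl | hx
    · omega
    · exact ih x hx
  | param _ ih =>
    intro x hx
    rcases List.mem_cons.1 hx with rfl | hx
    · omega
    · have := ih x hx; omega

theorem zero_iff {t : ℕ} {w : List ℕ} : IsParamWord t w 0 ↔ ∀ x ∈ w, x < t := by
  constructor
  · intro h; simpa using h.mem_lt
  · intro h
    induction w with
    | nil => exact .nil t
    | cons a w ih => exact .letter (h a (by simp)) (ih fun x hx => h x (by simp [hx]))

theorem map {s l : ℕ} {w : List ℕ} (h : IsParamWord s w l) :
    ∀ {t k : ℕ} (τ : ℕ → ℕ), (∀ x < s, τ x < t) →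
      IsParamWord t ((List.range' s l).map τ) k → IsParamWord t (w.map τ) k := by
  induction h with
  | nil => intro t k τ _ h; simpa using h
  | letter ha _ ih => intro t k τ hτ h; exact .letter (hτ _ ha) (ih τ hτ h)
  | @param s l w _ ih =>
    intro t k τ hτ h
    rw [List.range'_succ, List.map_cons] at h
    rw [List.map_cons]
    generalize hb : τ s = b at h
    cases h with
    | letter hbt h =>
      refine .letter hbt (ih τ (fun x hx => ?_) h)
      rcases Nat.lt_succ_iff_lt_or_eq.1 hx with hx | rfl
      · exact hτ x hx
      · omega
    | param h =>
      refine .param (ih τ (fun x hx => ?_) h)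
      rcases Nat.lt_succ_iff_lt_or_eq.1 hx with hx | rfl
      · have := hτ x hx; omega
      · omega

theorem map_range'_wordSubst (t : ℕ) (g : List ℕ) :
    (List.range' t g.length).map (wordSubst t g) = g := by
  apply List.ext_getElem
  · simp
  · intro i h1 h2
    simp [wordSubst_add h2]

theorem subst {t l k : ℕ} {w g : List ℕ} (hw : IsParamWord t w l) (hg : IsParamWord t g k)
    (hl : g.length = l) : IsParamWord t (w.map (wordSubst t g)) k := by
  subst hl
  refine hw.map _ (fun x hx => by rwa [wordSubst_of_lt _ hx]) ?_
  rwa [map_range'_wordSubst]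

theorem range' (t k : ℕ) : IsParamWord t (List.range' t k) k := by
  induction k generalizing t with
  | zero => exact .nil t
  | succ k ih => rw [List.range'_succ]; exact .param (ih _)

theorem append {t k k' : ℕ} {w w' : List ℕ} (h : IsParamWord t w k)
    (h' : IsParamWord (t + k) w' k') : IsParamWord t (w ++ w') (k + k') := by
  induction h with
  | nil => simpa using h'
  | letter ha _ ih => exact .letter ha (ih h')
  | @param t k w _ ih =>
    have := ih (by rwa [show t + 1 + k = t + (k + 1) by omega])
    rw [show k + 1 + k' = k + k' + 1 by omega]
    exact .param this

theorem of_mem_le {t : ℕ} {w : List ℕ} (h : ∀ x ∈ w, x ≤ t) (ht : t ∈ w) :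
    IsParamWord t w 1 := by
  induction w with
  | nil => simp at ht
  | cons a w ih =>
    rcases (h a (by simp)).lt_or_eq with ha | rfl
    · refine .letter ha (ih (fun x hx => h x (by simp [hx])) ?_)
      rcases List.mem_cons.1 ht with rfl | ht
      · omega
      · exact ht
    · exact .param (zero_iff.2 fun x hx => Nat.lt_succ_of_le (h x (by simp [hx])))

theorem subst_comp {t l m : ℕ} {w g : List ℕ} (hw : IsParamWord t w l) (hl : g.length = l)
    (p : List ℕ) (hm : m = t) :
    (w.map (wordSubst t g)).map (wordSubst m p) =
      w.map (wordSubst t (g.map (wordSubst m p))) := by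
  subst hm
  rw [List.map_map]
  refine List.map_congr_left fun x hx => ?_
  have hx := hw.mem_lt x hx
  by_cases h : x < m
  · simp [wordSubst_of_lt _ h]
  · obtain ⟨d, rfl⟩ : ∃ d, x = m + d := ⟨x - m, by omega⟩
    rw [Function.comp, wordSubst_add (by omega), wordSubst_add (by simp; omega)]
    simp

theorem letterPrefix_map_congr {s l : ℕ} {w : List ℕ} (h : IsParamWord s w l) {t : ℕ} :
    ∀ (σ τ : ℕ → ℕ) (i : ℕ), (∀ x < s + i, σ x = τ x) →
      (i < l → t ≤ σ (s + i) ∧ t ≤ τ (s + i)) →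
      letterPrefix t (w.map σ) = letterPrefix t (w.map τ) := by
  induction h with
  | nil => intros; rfl
  | letter ha _ ih =>
    intro σ τ i h1 h2
    have := ih σ τ i h1 h2
    simp only [letterPrefix, List.map_cons, List.takeWhile_cons] at this ⊢
    rw [h1 _ (by omega), this]
  | @param s l w _ ih =>
    intro σ τ i h1 h2
    cases i with
    | zero =>
      obtain ⟨h3, h4⟩ := h2 (by omega)
      simp only [letterPrefix, List.map_cons, List.takeWhile_cons]
      rw [if_neg (by simpa using h3), if_neg (by simpa using h4)]
    | succ i =>
      have := ih σ τ i (fun x hx => h1 x (by omega)) (fun hi => by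
        have := h2 (by omega)
        rwa [show s + 1 + i = s + (i + 1) by omega])
      simp only [letterPrefix, List.map_cons, List.takeWhile_cons] at this ⊢
      rw [h1 _ (by omega), this]

end IsParamWord

theorem letterPrefix_lt {t : ℕ} {w : List ℕ} : ∀ x ∈ letterPrefix t w, x < t := fun x hx => by
  simpa using List.mem_takeWhile_imp hx

theorem letterPrefix_eq_self {t : ℕ} {w : List ℕ} (h : ∀ x ∈ w, x < t) :
    letterPrefix t w = w := by
  simpa [letterPrefix, List.takeWhile_eq_self_iff] using h

theorem letterPrefix_append {t y : ℕ} (w : List ℕ) (hy : t ≤ y) :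
    letterPrefix t (w ++ [y]) = letterPrefix t w := by
  induction w with
  | nil => simp [letterPrefix, hy]
  | cons a w ih =>
    simp only [letterPrefix, List.cons_append, List.takeWhile_cons] at ih ⊢
    rw [ih]

theorem letterPrefix_append_of_lt {t : ℕ} (w v : List ℕ)
    (h : (letterPrefix t w).length < w.length) :
    letterPrefix t (w ++ v) = letterPrefix t w := by
  induction w with
  | nil => simp at h
  | cons a w ih =>
    simp only [letterPrefix, List.cons_append, List.takeWhile_cons] at ih h ⊢
    split_ifs at h ⊢ with ha
    · rw [ih (by simpa using h)]
    · rfl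

theorem IsParamWord.letterPrefix_length_lt {t k : ℕ} {w : List ℕ} (h : IsParamWord t w (k + 1)) :
    (letterPrefix t w).length < w.length := by
  generalize hk : k + 1 = k' at h
  induction h with
  | nil => omega
  | letter ha _ ih => simpa [letterPrefix, ha] using ih hk
  | param _ _ => simp [letterPrefix]

/-- The letters of `w` before the first parameter not covered by the letter prefix of `g`
depend only on this prefix. -/
theorem IsParamWord.letterPrefix_subst {t l : ℕ} {w g : List ℕ} (hw : IsParamWord t w l)
    (hl : g.length = l) :
    letterPrefix t (w.map (wordSubst t g)) =
      letterPrefix t (w.map (wordSubst t (letterPrefix t g))) := by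
  subst hl
  have hp : letterPrefix t g <+: g := List.takeWhile_prefix _
  refine hw.letterPrefix_map_congr _ _ (letterPrefix t g).length (fun x hx => ?_) fun hi => ⟨?_, ?_⟩
  · by_cases h : x < t
    · simp [wordSubst_of_lt _ h]
    · obtain ⟨d, rfl⟩ : ∃ d, x = t + d := ⟨x - t, by omega⟩
      have hd : d < (letterPrefix t g).length := by omega
      rw [wordSubst_add hd, wordSubst_add (hd.trans_le hp.length_le), hp.getElem]
  · rw [wordSubst_add hi]
    by_contra! hlt
    have : ∀ g : List ℕ, ∀ hi : (letterPrefix t g).length < g.length,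
        t ≤ g[(letterPrefix t g).length] := by
      intro g
      induction g with
      | nil => simp
      | cons a g ih =>
        intro hi
        by_cases ha : a < t
        · have e : letterPrefix t (a :: g) = a :: letterPrefix t g := by
            simp [letterPrefix, ha]
          simp only [e, List.length_cons, List.getElem_cons_succ] at hi ⊢
          exact ih (by omega)
        · have e : letterPrefix t (a :: g) = [] := by
            simp [letterPrefix, ha]
          simp only [e, List.length_nil, List.getElem_cons_zero]
          omega
    have := this g hi
    omega
  · rw [wordSubst_of_ge le_rfl]; omega

/-- Hales–Jewett theorem for parameter words. -/
theorem exists_paramWord_mono_letters (t : ℕ) (ht : 0 < t) (m : ℕ) :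
    ∀ (κ : Type) [Finite κ], ∃ n, ∀ ψ : List ℕ → κ, ∃ w, w.length = n ∧ IsParamWord t w m ∧
      ∃ c, ∀ g, (∀ x ∈ g, x < t) → g.length = m → ψ (w.map (wordSubst t g)) = c := by
  induction m with
  | zero =>
    intro κ _
    refine ⟨0, fun ψ => ⟨[], rfl, .nil t, ψ [], fun g _ _ => rfl⟩⟩
  | succ m ih =>
    intro κ _
    obtain ⟨n₁, h₁⟩ := ih κ
    obtain ⟨ι, _, h₂⟩ := Combinatorics.Line.exists_mono_in_high_dimension (Fin t)
      ((Fin n₁ → Fin t) → κ)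
    let e := Fintype.equivFin ι
    refine ⟨n₁ + Fintype.card ι, fun ψ => ?_⟩
    obtain ⟨L, c₂, hL⟩ := h₂ fun v u =>
      ψ ((List.ofFn fun i => (u i : ℕ)) ++ List.ofFn fun i => (v (e.symm i) : ℕ))
    let F (y : ℕ) : List ℕ := List.ofFn fun i => ((L.idxFun (e.symm i)).map Fin.val).getD y
    have hF (a : Fin t) : F a = List.ofFn fun i => ((L a (e.symm i) : Fin t) : ℕ) := by
      refine congrArg List.ofFn (funext fun i => ?_)
      rw [Combinatorics.Line.apply_def]
      simp only
      cases L.idxFun (e.symm i) <;> rfl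
    have hFmem (y : ℕ) : ∀ x ∈ F y, x < t ∨ x = y := by
      intro x hx
      obtain ⟨i, rfl⟩ := (List.mem_ofFn' _ _).1 hx
      dsimp only
      cases L.idxFun (e.symm i) with
      | none => simp
      | some b => simp
    obtain ⟨w, hwl, hw, c, hc⟩ := h₁ fun v => ψ (v ++ F 0)
    refine ⟨w ++ F (t + m), by simp [F, hwl], ?_, c, ?_⟩
    · refine hw.append (IsParamWord.of_mem_le (fun x hx => ?_) ?_)
      · rcases hFmem _ x hx with h | h <;> omega
      · obtain ⟨i, hi⟩ := L.proper
        refine (List.mem_ofFn' _ _).2 ⟨e i, ?_⟩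
        simp [hi]
    · intro g hg hgl
      have hm : m < g.length := by omega
      have hgm : g[m] < t := hg _ (List.getElem_mem _)
      have e1 : (F (t + m)).map (wordSubst t g) = F g[m] := by
        rw [List.map_ofFn]
        refine congrArg List.ofFn (funext fun i => ?_)
        simp only [Function.comp]
        cases L.idxFun (e.symm i) with
        | none => simp [wordSubst_add hm]
        | some b => simp [wordSubst_of_lt]
      have e2 : w.map (wordSubst t g) = w.map (wordSubst t (g.take m)) := by
        refine List.map_congr_left fun x hx => ?_
        have hx := hw.mem_lt x hx
        by_cases h : x < t
        · simp [wordSubst_of_lt _ h]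
        · obtain ⟨d, rfl⟩ : ∃ d, x = t + d := ⟨x - t, by omega⟩
          rw [wordSubst_add (by omega), wordSubst_add (by simp; omega)]
          simp
      have hg' : ∀ x ∈ g.take m, x < t := fun x hx => hg x (List.mem_of_mem_take hx)
      have hl' : (g.take m).length = m := by simp; omega
      rw [List.map_append, e1, e2, ← hc _ hg' hl']
      set v := w.map (wordSubst t (g.take m)) with hv
      have hvt : ∀ x ∈ v, x < t :=
        IsParamWord.zero_iff.1 (hw.subst (IsParamWord.zero_iff.2 hg') hl')
      have hvl : v.length = n₁ := by simp [hv, hwl]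
      obtain ⟨u, hu⟩ : ∃ u : Fin n₁ → Fin t, v = List.ofFn fun i => (u i : ℕ) := by
        refine ⟨fun i => ⟨v[i]'(by omega), hvt _ (List.getElem_mem _)⟩, ?_⟩
        apply List.ext_getElem
        · simp [hvl]
        · intros; simp
      have k1 := congrFun (hL ⟨g[m], hgm⟩) u
      have k2 := congrFun (hL ⟨0, ht⟩) u
      simp only [← hF, ← hu] at k1 k2
      rw [k1, k2]

/-- Every colouring of words admits a parameter word for which the colour of the letter prefix
of a partial substitution depends only on the number of substituted letters. -/
theorem exists_paramWord_prefix_level (t : ℕ) (ht : 0 < t) (κ : Type) [Finite κ] (l : ℕ) :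
    ∃ n, ∀ ψ : List ℕ → κ, ∃ w, w.length = n ∧ IsParamWord t w l ∧
      ∃ c : ℕ → κ, ∀ p, (∀ x ∈ p, x < t) → p.length < l →
        ψ (letterPrefix t (w.map (wordSubst t p))) = c p.length := by
  induction l with
  | zero =>
    refine ⟨0, fun ψ => ⟨[], rfl, .nil t, fun _ => ψ [], fun p _ hp => ?_⟩⟩
    omega
  | succ l ih =>
    obtain ⟨m, hm⟩ := ih
    obtain ⟨n, hn⟩ := exists_paramWord_mono_letters t ht m κ
    refine ⟨n + 1, fun ψ => ?_⟩
    obtain ⟨w, hwl, hw, c₀, hc₀⟩ := hn ψ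
    obtain ⟨v, hvl, hv, c, hc⟩ := hm fun p => ψ (letterPrefix t (w.map (wordSubst t p)))
    refine ⟨w.map (wordSubst t v) ++ [t + l], by simp [hwl],
      (hw.subst hv hvl).append (.param (.nil _)), fun i => if i = l then c₀ else c i,
      fun p hp hpl => ?_⟩
    rw [List.map_append, List.map_singleton, wordSubst_of_ge (by omega),
      letterPrefix_append _ (by omega), hw.subst_comp hvl _ rfl]
    beta_reduce
    by_cases h : p.length = l
    · have hvp : IsParamWord t (v.map (wordSubst t p)) 0 :=
        hv.subst (IsParamWord.zero_iff.2 hp) h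
      have hlen : (v.map (wordSubst t p)).length = m := by simpa using hvl
      rw [letterPrefix_eq_self (IsParamWord.zero_iff.1 (hw.subst hvp hlen)), if_pos h]
      exact hc₀ _ (IsParamWord.zero_iff.1 hvp) hlen
    · rw [if_neg h, hw.letterPrefix_subst (by simpa using hvl)]
      exact hc p hp (by omega)

/-- Parameters can be made to occur for the first time exactly at prescribed positions. -/
theorem exists_paramWord_prefix_length_mem (t : ℕ) (ht : 0 < t) (S : Set ℕ) (n : ℕ) :
    ∀ l ≤ ((Finset.range n).filter (· ∈ S)).card, ∃ w, w.length = n ∧ IsParamWord t w l ∧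
      ∀ p, (∀ x ∈ p, x < t) → p.length < l →
        (letterPrefix t (w.map (wordSubst t p))).length < n ∧
        (letterPrefix t (w.map (wordSubst t p))).length ∈ S := by
  induction n with
  | zero =>
    intro l hl
    obtain rfl : l = 0 := by simpa using hl
    exact ⟨[], rfl, .nil t, fun p _ h => by omega⟩
  | succ n ih =>
    intro l hl
    rw [Finset.range_add_one, Finset.filter_insert] at hl
    have hskip : l ≤ ((Finset.range n).filter (· ∈ S)).card → ∃ w, w.length = n + 1 ∧
        IsParamWord t w l ∧ ∀ p, (∀ x ∈ p, x < t) → p.length < l →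
        (letterPrefix t (w.map (wordSubst t p))).length < n + 1 ∧
        (letterPrefix t (w.map (wordSubst t p))).length ∈ S := by
      intro hl
      obtain ⟨w, hwl, hw, h⟩ := ih l hl
      refine ⟨w ++ [0], by simp [hwl], hw.append (.letter (by omega) (.nil _)),
        fun p hp hpl => ?_⟩
      obtain ⟨h1, h2⟩ := h p hp hpl
      rw [List.map_append, letterPrefix_append_of_lt _ _ (by simpa [hwl] using h1)]
      exact ⟨by omega, h2⟩
    by_cases hn : n ∈ S
    · rw [if_pos hn, Finset.card_insert_of_notMem (by simp)] at hl
      cases l with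
      | zero => exact hskip (Nat.zero_le _)
      | succ l =>
        obtain ⟨w, hwl, hw, h⟩ := ih l (by omega)
        refine ⟨w ++ [t + l], by simp [hwl], hw.append (.param (.nil _)), fun p hp hpl => ?_⟩
        rw [List.map_append, List.map_singleton, wordSubst_of_ge (by omega),
          letterPrefix_append _ (by omega)]
        by_cases hpe : p.length = l
        · rw [letterPrefix_eq_self
            (IsParamWord.zero_iff.1 (hw.subst (IsParamWord.zero_iff.2 hp) hpe))]
          simpa [hwl] using hn
        · obtain ⟨h1, h2⟩ := h p hp (by omega)
          exact ⟨by omega, h2⟩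
    · rw [if_neg hn] at hl
      exact hskip hl

/-- Every colouring of words admits a parameter word for which the letter prefixes of all
proper partial substitutions have the same colour. -/
theorem exists_paramWord_prefix_mono (t : ℕ) (ht : 0 < t) (κ : Type) [Finite κ] (l : ℕ) :
    ∃ n, ∀ ψ : List ℕ → κ, ∃ w, w.length = n ∧ IsParamWord t w l ∧
      ∃ c, ∀ p, (∀ x ∈ p, x < t) → p.length < l →
        ψ (letterPrefix t (w.map (wordSubst t p))) = c := by
  have := Fintype.ofFinite κ
  obtain ⟨n, hn⟩ := exists_paramWord_prefix_level t ht κ (Fintype.card κ * l)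
  refine ⟨n, fun ψ => ?_⟩
  have : Nonempty κ := ⟨ψ []⟩
  obtain ⟨w, hwl, hw, c, hc⟩ := hn ψ
  obtain ⟨c₀, -, hc₀⟩ := Finset.exists_le_card_fiber_of_mul_le_card_of_maps_to
    (s := Finset.range (Fintype.card κ * l)) (t := Finset.univ) (f := c) (n := l)
    (fun _ _ => Finset.mem_univ _) Finset.univ_nonempty (by simp)
  obtain ⟨v, hvl, hv, h⟩ := exists_paramWord_prefix_length_mem t ht {i | c i = c₀}
    (Fintype.card κ * l) l (by simpa using hc₀)
  refine ⟨w.map (wordSubst t v), by simp [hwl], hw.subst hv hvl, c₀, fun p hp hpl => ?_⟩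
  obtain ⟨h1, h2⟩ := h p hp hpl
  rw [hw.subst_comp hvl _ rfl, hw.letterPrefix_subst (by simpa using hvl)]
  rw [hc _ letterPrefix_lt h1]
  exact h2

/-- The Graham–Rothschild property for words with `k` parameters. -/
def GrahamRothschild (k : ℕ) : Prop :=
  ∀ t, 0 < t → ∀ (κ : Type) [Finite κ] (l : ℕ), ∃ n, ∀ χ : List ℕ → κ, ∃ w, w.length = n ∧
    IsParamWord t w l ∧ ∃ c, ∀ g, IsParamWord t g k → g.length = l →
      χ (w.map (wordSubst t g)) = c

/-- Reduction to colourings which depend only on the letter prefix. -/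
theorem GrahamRothschild.exists_prefix {k : ℕ} (hk : GrahamRothschild k) (t : ℕ) (ht : 0 < t)
    (m : ℕ) : ∀ (κ : Type) [Finite κ], ∃ n, ∀ χ : List ℕ → κ, ∃ w, w.length = n ∧
      IsParamWord t w m ∧ ∃ ψ : List ℕ → κ, ∀ g, IsParamWord t g (k + 1) → g.length = m →
        χ (w.map (wordSubst t g)) = ψ (letterPrefix t g) := by
  induction m with
  | zero =>
    intro κ _
    refine ⟨0, fun χ => ⟨[], rfl, .nil t, fun _ => χ [], fun g hg _ => rfl⟩⟩
  | succ m ih =>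
    intro κ _
    obtain ⟨m', hm'⟩ := ih (Fin t → κ)
    obtain ⟨n, hn⟩ := hk (t + 1) (by omega) κ m'
    refine ⟨n + 1, fun χ => ?_⟩
    obtain ⟨H, hHl, hH, c, hc⟩ := hn fun w => χ (t :: w)
    obtain ⟨F, hFl, hF, ψ, hψ⟩ :=
      hm' fun w a => χ (a :: H.map (wordSubst t ((a : ℕ) :: w)))
    let sh : ℕ → ℕ := fun x => if x < t then x else x + 1
    have hsF : IsParamWord (t + 1) (F.map sh) m := by
      refine hF.map sh (fun x hx => by simp only [sh, hx, if_true]; omega) ?_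
      have : (List.range' t m).map sh = List.range' (t + 1) m := by
        apply List.ext_getElem
        · simp
        · intro i h1 h2
          simp [sh]; omega
      rw [this]
      exact .range' _ _
    refine ⟨t :: H.map (wordSubst (t + 1) (F.map sh)), by simp [hHl],
      .param (hH.subst hsF (by simpa using hFl)),
      fun p => p.casesOn c fun a p => if h : a < t then ψ p ⟨a, h⟩ else c, fun g hg hgl => ?_⟩
    cases hg with
    | @letter _ a _ g ha hg =>
      have hgm : g.length = m := by simpa using hgl
      have e1 : letterPrefix t (a :: g) = a :: letterPrefix t g := by simp [letterPrefix, ha]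
      have key := congrFun (hψ g hg hgm) ⟨a, ha⟩
      simp only [e1, ha, dif_pos, ← key]
      congr 1
      rw [List.map_cons, List.map_map]
      congr 1
      · simp [wordSubst]
      refine List.map_congr_left fun x hx => ?_
      have hx := hH.mem_lt x hx
      rw [Function.comp]
      rcases lt_trichotomy x t with h | rfl | h
      · rw [wordSubst_of_lt _ (h.trans (Nat.lt_succ_self t)), wordSubst_of_lt _ h,
          wordSubst_of_lt _ h]
      · rw [wordSubst_of_lt _ (Nat.lt_succ_self x)]
        simp [wordSubst]
      · obtain ⟨d, rfl⟩ : ∃ d, x = t + 1 + d := ⟨x - (t + 1), by omega⟩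
        have hd : d < F.length := by omega
        rw [wordSubst_add (by simpa using hd), add_assoc t 1 d, add_comm 1 d,
          wordSubst_add (by simpa using hd)]
        simp only [List.getElem_map, List.getElem_cons_succ]
        have hy := hF.mem_lt F[d] (List.getElem_mem _)
        generalize F[d] = y at hy
        by_cases h : y < t
        · simp [sh, h, wordSubst_of_lt]
        · obtain ⟨b, rfl⟩ : ∃ b, y = t + b := ⟨y - t, by omega⟩
          have : sh (t + b) = t + (b + 1) := by simp [sh]; omega
          rw [this, wordSubst_add (by simp; omega), wordSubst_add (by omega)]
          simp
    | @param _ _ h hh =>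
      have hhl : h.length = m := by simpa using hgl
      have e1 : letterPrefix t (t :: h) = [] := by simp [letterPrefix]
      simp only [e1]
      rw [wordSubst_cons_self, List.map_cons, wordSubst_of_lt _ (Nat.lt_succ_self t),
        hH.subst_comp (by simpa using hFl) _ rfl]
      exact hc _ (hsF.subst hh hhl) (by simpa using hFl)

/-- The Graham–Rothschild theorem. -/
theorem grahamRothschild (k : ℕ) : GrahamRothschild k := by
  induction k with
  | zero =>
    intro t ht κ _ l
    obtain ⟨n, hn⟩ := exists_paramWord_mono_letters t ht l κ
    refine ⟨n, fun χ => ?_⟩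
    obtain ⟨w, hwl, hw, c, hc⟩ := hn χ
    exact ⟨w, hwl, hw, c, fun g hg => hc g (IsParamWord.zero_iff.1 hg)⟩
  | succ k ih =>
    intro t ht κ _ l
    obtain ⟨m, hm⟩ := exists_paramWord_prefix_mono t ht κ l
    obtain ⟨n, hn⟩ := ih.exists_prefix t ht m κ
    refine ⟨n, fun χ => ?_⟩
    obtain ⟨F, hFl, hF, ψ, hψ⟩ := hn χ
    obtain ⟨G, hGl, hG, c, hc⟩ := hm ψ
    refine ⟨F.map (wordSubst t G), by simp [hFl], hF.subst hG hGl, c, fun g hg hgl => ?_⟩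
    rw [hF.subst_comp hGl _ rfl, hψ _ (hG.subst hg hgl) (by simpa using hGl),
      hG.letterPrefix_subst hgl]
    exact hc _ letterPrefix_lt (hgl ▸ hg.letterPrefix_length_lt)

/-- The finite dual Ramsey theorem, for rigid surjections encoded as parameter words. -/
theorem finite_dual_ramsey (κ : Type) [Finite κ] (l k : ℕ) (hl : 0 < l) (hk : 0 < k) :
    ∃ n, ∀ χ : List ℕ → κ, ∃ w, w.length = n ∧ IsParamWord 0 w l ∧
      ∃ c, ∀ g, IsParamWord 0 g k → g.length = l → χ (w.map (wordSubst 0 g)) = c := by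
  obtain ⟨l, rfl⟩ := Nat.exists_eq_add_of_lt hl
  obtain ⟨k, rfl⟩ := Nat.exists_eq_add_of_lt hk
  simp only [Nat.zero_add]
  obtain ⟨n, hn⟩ := grahamRothschild k 1 one_pos κ l
  refine ⟨n + 1, fun χ => ?_⟩
  obtain ⟨w, hwl, hw, c, hc⟩ := hn fun w => χ (0 :: w)
  refine ⟨0 :: w, by simp [hwl], .param hw, c, fun g hg hgl => ?_⟩
  cases hg with
  | letter h _ => omega
  | param hg =>
    rw [wordSubst_cons_self, List.map_cons, wordSubst_of_lt _ (by omega)]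
    exact hc _ hg (by simpa using hgl)

/-- Parameter words are exactly the words in which every parameter occurs at some position
with only smaller values before it. -/
theorem isParamWord_iff {t k : ℕ} {w : List ℕ} :
    IsParamWord t w k ↔ (∀ x ∈ w, x < t + k) ∧ ∀ i, t ≤ i → i < t + k →
      ∃ (j : ℕ) (hj : j < w.length), w[j] = i ∧ ∀ (j' : ℕ) (h : j' < j), w[j'] < i := by
  constructor
  · intro h
    refine ⟨h.mem_lt, ?_⟩
    induction h with
    | nil => intros; omega
    | @letter t a k w ha _ ih =>
      intro i h1 h2
      obtain ⟨j, hj, h3, h4⟩ := ih i h1 h2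
      refine ⟨j + 1, by simpa using hj, by simpa using h3, fun j' hj' => ?_⟩
      cases j' with
      | zero => simp; omega
      | succ j' => simpa using h4 j' (by omega)
    | @param t k w _ ih =>
      intro i h1 h2
      rcases h1.eq_or_lt with rfl | h1
      · exact ⟨0, by simp, by simp, fun j' h => by omega⟩
      obtain ⟨j, hj, h3, h4⟩ := ih i h1 (by omega)
      refine ⟨j + 1, by simpa using hj, by simpa using h3, fun j' hj' => ?_⟩
      cases j' with
      | zero => simp; omega
      | succ j' => simpa using h4 j' (by omega)
  · rintro ⟨hlt, h⟩
    induction w generalizing t k with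
    | nil =>
      cases k with
      | zero => exact .nil t
      | succ k =>
        obtain ⟨j, hj, -⟩ := h t le_rfl (by omega)
        simp at hj
    | cons a w ih =>
      have step : ∀ i, t ≤ i → i < t + k → a < i ∨ a = i := by
        intro i h1 h2
        obtain ⟨j, hj, h3, h4⟩ := h i h1 h2
        cases j with
        | zero => right; simpa using h3
        | succ j => left; simpa using h4 0 (by omega)
      have tail : ∀ i, t ≤ i → i < t + k → a ≠ i →
          ∃ (j : ℕ) (hj : j < w.length), w[j] = i ∧ ∀ (j' : ℕ) (h : j' < j), w[j'] < i := by
        intro i h1 h2 h5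
        obtain ⟨j, hj, h3, h4⟩ := h i h1 h2
        cases j with
        | zero => exact absurd (by simpa using h3) h5
        | succ j =>
          exact ⟨j, by simpa using hj, by simpa using h3,
            fun j' hj' => by simpa using h4 (j' + 1) (by omega)⟩
      by_cases ha : a < t
      · exact .letter ha (ih (fun x hx => hlt x (by simp [hx]))
          fun i h1 h2 => tail i h1 h2 (by omega))
      · have hak := hlt a (by simp)
        obtain ⟨k, rfl⟩ : ∃ k', k = k' + 1 := ⟨k - 1, by omega⟩
        obtain rfl : a = t := by
          rcases step t le_rfl (by omega) with h | h <;> omega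
        refine .param (ih (fun x hx => ?_) fun i h1 h2 => tail i (by omega) (by omega) (by omega))
        have := hlt x (by simp [hx])
        omega

/-! ### The special anti-lexicographic order on tuples of ersts -/

theorem altLex_iff_toColex_lt {X : Type*} [LinearOrder X] {s t : Finset X} :
    altLex s t ↔ toColex s < toColex t := by
  rw [Finset.Colex.toColex_lt_toColex_iff_exists_forall_lt]
  constructor
  · rintro ⟨m, hmt, hms, h⟩
    refine ⟨m, hmt, hms, fun b hbs hbt => ?_⟩
    rcases lt_trichotomy b m with hb | rfl | hb
    · exact hb
    · exact absurd hbs hms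
    · exact absurd ((h b hb).1 hbs) hbt
  · rintro ⟨a, hat, has, h⟩
    obtain ⟨m, hm, hmax⟩ := (t \ s).exists_max_image id ⟨a, by simp [hat, has]⟩
    rw [Finset.mem_sdiff] at hm
    refine ⟨m, hm.1, hm.2, fun z hz => ⟨fun hzs => ?_, fun hzt => ?_⟩⟩
    · by_contra hzt
      have h1 := h z hzs hzt
      have h2 : a ≤ m := hmax a (by simp [hat, has])
      exact absurd (h1.trans_le h2) hz.asymm
    · by_contra hzs
      exact absurd (hmax z (by simp [hzt, hzs])) (not_le.2 hz)

/-- Tuples are compared by the number of their entries, then by the set of entries. -/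
def tupleKey {X : Type*} [LinearOrder X] (l : List X) : ℕ ×ₗ Colex (Finset X) :=
  toLex (l.toFinset.card, toColex l.toFinset)

theorem tupleKey_lt_iff {X : Type*} [LinearOrder X] {l l' : List X} :
    tupleKey l < tupleKey l' ↔ l.toFinset.card < l'.toFinset.card ∨
      l.toFinset.card = l'.toFinset.card ∧ toColex l.toFinset < toColex l'.toFinset := by
  simp [tupleKey, Prod.Lex.toLex_lt_toLex]

theorem tpRel_replicate {X : Type*} [LinearOrder X] (n : ℕ) (a : X) :
    tpRel (List.replicate n a) = fun i j => i < n ∧ j < n := by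
  funext i j
  simp [tpRel]

theorem tpRel_of_pairwise {X : Type*} [LinearOrder X] {l : List X} (h : l.Pairwise (· < ·)) :
    tpRel l = fun i j => i < l.length ∧ j < l.length ∧ i ≤ j := by
  funext i j
  have hm : StrictMono l.get := List.sortedLT_iff_strictMono_get.1 (List.sortedLT_iff_pairwise.2 h)
  simp only [tpRel, hm.le_iff_le, Fin.mk_le_mk, eq_iff_iff]
  constructor
  · rintro ⟨h1, h2, h3⟩; exact ⟨h1, h2, h3⟩
  · rintro ⟨h1, h2, h3⟩; exact ⟨h1, h2, h3⟩

theorem card_classesOf_full {n : ℕ} (hn : 0 < n) :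
    (classesOf (fun i j => i < n ∧ j < n) n).card = 1 := by
  rw [Finset.card_eq_one]
  refine ⟨Finset.range n, ?_⟩
  ext s
  simp only [classesOf, Finset.mem_image, Finset.mem_range, Finset.mem_singleton]
  have : ∀ i < n, classOf (fun i j => i < n ∧ j < n) n i = Finset.range n := by
    intro i hi
    ext j
    simp only [classOf, Finset.mem_filter, Finset.mem_range]
    tauto
  constructor
  · rintro ⟨i, hi, rfl⟩; exact this i hi
  · rintro rfl; exact ⟨0, hn, this 0 hn⟩

theorem card_classesOf_linear (n : ℕ) :
    (classesOf (fun i j => i < n ∧ j < n ∧ i ≤ j) n).card = n := by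
  have : ∀ i < n, classOf (fun i j => i < n ∧ j < n ∧ i ≤ j) n i = {i} := by
    intro i hi
    ext j
    simp only [classOf, Finset.mem_filter, Finset.mem_range, Finset.mem_singleton]
    omega
  rw [classesOf, Finset.card_image_of_injOn, Finset.card_range]
  intro i hi j hj hij
  simp only [Finset.coe_range, Set.mem_Iio] at hi hj
  simpa [this i hi, this j hj] using hij

theorem quasiLT_irrefl (n : ℕ) (σ : ℕ → ℕ → Prop) : ¬ quasiLT n σ σ := by
  rintro (h | ⟨-, M, h1, h2, -⟩)
  · exact lt_irrefl _ h
  · exact h2 h1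

/-- Constant or strictly increasing lists of length `n`. -/
def IsErstTuple {X : Type*} [LinearOrder X] (n : ℕ) (l : List X) : Prop :=
  l.length = n ∧ ((∃ a, l = List.replicate n a) ∨ l.Pairwise (· < ·))

theorem card_toFinset_replicate {X : Type*} [LinearOrder X] {n : ℕ} (hn : 0 < n) (a : X) :
    (List.replicate n a).toFinset = {a} :=
  List.toFinset_replicate_of_ne_zero hn.ne'

theorem card_toFinset_of_pairwise {X : Type*} [LinearOrder X] {l : List X}
    (h : l.Pairwise (· < ·)) : l.toFinset.card = l.length :=
  List.toFinset_card_of_nodup (h.imp fun h => h.ne)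

theorem sort_toFinset_of_pairwise {X : Type*} [LinearOrder X] {l : List X}
    (h : l.Pairwise (· < ·)) : l.toFinset.sort = l :=
  (List.toFinset_sort (· ≤ ·) (h.imp fun h => h.ne)).2 (h.imp fun h => h.le)

theorem salLT_iff_of_tpRel_eq {X : Type*} [LinearOrder X] {l l' : List X}
    (hl : l.length = l'.length) (ht : tpRel l = tpRel l')
    (hc : l.toFinset.card = l'.toFinset.card) : salLT l l' ↔ tupleKey l < tupleKey l' := by
  rw [tupleKey_lt_iff, salLT, ht, altLex_iff_toColex_lt]
  have h1 := quasiLT_irrefl l.length (tpRel l')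
  constructor
  · rintro ⟨-, h | ⟨-, -, h⟩⟩
    · exact absurd h h1
    · exact Or.inr ⟨hc, h⟩
  · rintro (h | ⟨-, h⟩)
    · omega
    · exact ⟨hl, Or.inr ⟨rfl, fun e => h.ne (congrArg toColex e), h⟩⟩

theorem IsErstTuple.cases {X : Type*} [LinearOrder X] {n : ℕ} {l : List X}
    (h : IsErstTuple n l) (hn : 0 < n) :
    (∃ a, l = List.replicate n a) ∨ (2 ≤ n ∧ l.length = n ∧ l.Pairwise (· < ·)) := by
  obtain ⟨hl, h | h⟩ := h
  · exact Or.inl h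
  · by_cases h2 : 2 ≤ n
    · exact Or.inr ⟨h2, hl, h⟩
    · obtain rfl : n = 1 := by omega
      obtain ⟨a, rfl⟩ := List.length_eq_one_iff.1 hl
      exact Or.inl ⟨a, rfl⟩

theorem salLT_iff_tupleKey_lt {X : Type*} [LinearOrder X] {n : ℕ} {l l' : List X}
    (h : IsErstTuple n l) (h' : IsErstTuple n l') : salLT l l' ↔ tupleKey l < tupleKey l' := by
  have hlen : l.length = l'.length := h.1.trans h'.1.symm
  rcases Nat.eq_zero_or_pos n with rfl | hn
  · obtain rfl := List.length_eq_zero_iff.1 h.1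
    obtain rfl := List.length_eq_zero_iff.1 h'.1
    exact salLT_iff_of_tpRel_eq rfl rfl rfl
  rcases h.cases hn with ⟨a, rfl⟩ | ⟨h2, hl, hp⟩ <;>
    rcases h'.cases hn with ⟨b, rfl⟩ | ⟨h2', hl', hp'⟩
  · exact salLT_iff_of_tpRel_eq hlen (by simp [tpRel_replicate])
      (by simp [card_toFinset_replicate hn])
  · have h3 : tupleKey (List.replicate n a) < tupleKey l' := by
      rw [tupleKey_lt_iff, card_toFinset_replicate hn, card_toFinset_of_pairwise hp']
      left; simp; omega
    refine iff_of_true ⟨hlen, Or.inl (Or.inl ?_)⟩ h3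
    rw [tpRel_replicate, tpRel_of_pairwise hp', List.length_replicate, hl',
      card_classesOf_full hn, card_classesOf_linear]
    omega
  · have h3 : ¬ tupleKey l < tupleKey (List.replicate n b) := by
      rw [tupleKey_lt_iff, card_toFinset_replicate hn, card_toFinset_of_pairwise hp,
        Finset.card_singleton, hl]
      omega
    refine iff_of_false ?_ h3
    have e1 : (classesOf (tpRel l) n).card = n := by
      rw [tpRel_of_pairwise hp, hl, card_classesOf_linear]
    have e2 : (classesOf (tpRel (List.replicate n b)) n).card = 1 := by
      rw [tpRel_replicate, card_classesOf_full hn]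
    rintro ⟨-, (h | ⟨h, -⟩) | ⟨h, -⟩⟩
    · rw [hl, e1, e2] at h; omega
    · rw [hl, e1, e2] at h; omega
    · rw [h, e2] at e1; omega
  · refine salLT_iff_of_tpRel_eq hlen ?_ ?_
    · rw [tpRel_of_pairwise hp, tpRel_of_pairwise hp', hlen]
    · rw [card_toFinset_of_pairwise hp, card_toFinset_of_pairwise hp', hlen]

theorem tupleKey_injOn {X : Type*} [LinearOrder X] {n : ℕ} {l l' : List X}
    (h : IsErstTuple n l) (h' : IsErstTuple n l') (he : tupleKey l = tupleKey l') : l = l' := by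
  have hs : l.toFinset = l'.toFinset := by
    have := congrArg (fun p => ofColex (ofLex p).2) he
    exact this
  rcases Nat.eq_zero_or_pos n with rfl | hn
  · rw [List.length_eq_zero_iff.1 h.1, List.length_eq_zero_iff.1 h'.1]
  rcases h.cases hn with ⟨a, rfl⟩ | ⟨h2, hl, hp⟩ <;>
    rcases h'.cases hn with ⟨b, rfl⟩ | ⟨h2', hl', hp'⟩
  · rw [card_toFinset_replicate hn, card_toFinset_replicate hn, Finset.singleton_inj] at hs
    rw [hs]
  · have := congrArg Finset.card hs
    rw [card_toFinset_replicate hn, card_toFinset_of_pairwise hp', Finset.card_singleton] at this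
    omega
  · have := congrArg Finset.card hs
    rw [card_toFinset_replicate hn, card_toFinset_of_pairwise hp, Finset.card_singleton] at this
    omega
  · rw [← sort_toFinset_of_pairwise hp, ← sort_toFinset_of_pairwise hp', hs]

/-- Rigidity amounts to every point having a preimage below which the map stays below the
point. -/
theorem isRigidSurjOn_iff {α β K L : Type*} [LinearOrder K] [LinearOrder L]
    {ltA : α → α → Prop} {ltB : β → β → Prop} {S : Set α} {T : Set β} {f : α → β}
    {kA : α → K} {kB : β → L} (hS : S.Finite) (hA : Set.InjOn kA S) (hB : Set.InjOn kB T)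
    (hltA : ∀ a ∈ S, ∀ b ∈ S, (ltA a b ↔ kA a < kA b))
    (hltB : ∀ a ∈ T, ∀ b ∈ T, (ltB a b ↔ kB a < kB b)) :
    IsRigidSurjOn ltA ltB S T f ↔ (∀ a ∈ S, f a ∈ T) ∧
      ∀ y ∈ T, ∃ x ∈ S, f x = y ∧ ∀ x' ∈ S, kA x' < kA x → kB (f x') < kB y := by
  constructor
  · rintro ⟨h1, h2, h3⟩
    refine ⟨h1, ?_⟩
    have hmin : ∀ y ∈ T, ∃ x, MinWrt ltA {u | u ∈ S ∧ f u = y} x := by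
      intro y hy
      obtain ⟨x₀, hx₀, hfx₀⟩ := h2 y hy
      obtain ⟨x, hx, hx'⟩ := Set.exists_min_image {u | u ∈ S ∧ f u = y} kA
        (hS.subset fun u hu => hu.1) ⟨x₀, hx₀, hfx₀⟩
      refine ⟨x, hx, fun z hz => ?_⟩
      rcases (hx' z hz).eq_or_lt with h | h
      · exact Or.inl (hA hz.1 hx.1 h.symm)
      · exact Or.inr ((hltA _ hx.1 _ hz.1).2 h)
    intro y hy
    obtain ⟨x, hx⟩ := hmin y hy
    refine ⟨x, hx.1.1, hx.1.2, fun x' hx' hlt => ?_⟩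
    by_contra hnot
    rcases (not_lt.1 hnot).eq_or_lt with h | h
    · have := hB hy (h1 _ hx') h
      rcases hx.2 x' ⟨hx', this.symm⟩ with rfl | h'
      · exact lt_irrefl _ hlt
      · exact lt_asymm hlt ((hltA _ hx.1.1 _ hx').1 h')
    · obtain ⟨z, hz⟩ := hmin _ (h1 _ hx')
      have h4 := (hltA _ hx.1.1 _ hz.1.1).1
        (h3 y hy _ (h1 _ hx') ((hltB _ hy _ (h1 _ hx')).2 h) x z hx hz)
      rcases hz.2 x' ⟨hx', rfl⟩ with rfl | h'
      · exact lt_asymm hlt h4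
      · exact lt_asymm hlt (h4.trans ((hltA _ hz.1.1 _ hx').1 h'))
  · rintro ⟨h1, h2⟩
    refine ⟨h1, fun y hy => ?_, fun x hx y hy hxy a b ha hb => ?_⟩
    · obtain ⟨x, hx, hxy, -⟩ := h2 y hy
      exact ⟨x, hx, hxy⟩
    · rw [hltB _ hx _ hy] at hxy
      rw [hltA _ ha.1.1 _ hb.1.1]
      obtain ⟨p, hp, hpx, hp'⟩ := h2 x hx
      have hap : kA a ≤ kA p := by
        rcases ha.2 p ⟨hp, hpx⟩ with rfl | h
        · exact le_rfl
        · exact ((hltA _ ha.1.1 _ hp).1 h).le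
      refine lt_of_le_of_lt hap (lt_of_not_ge fun hle => ?_)
      rcases hle.eq_or_lt with h | h
      · have := hA hb.1.1 hp h
        rw [← hb.1.2, this, hpx] at hxy
        exact lt_irrefl _ hxy
      · have := hp' b hb.1.1 h
        rw [hb.1.2] at this
        exact lt_asymm hxy this

variable {Θ : Type} {ar : Θ → ℕ}

theorem ThetaErst.isErstTuple (M : ThetaErst Θ ar) {θ : Θ} {l : List M.carrier}
    (hl : l ∈ M.rel θ) : IsErstTuple (ar θ) l :=
  ⟨M.len θ l hl, (M.ext θ l hl).imp_right fun h => List.isChain_iff_pairwise.1 h⟩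

theorem ThetaErst.replicate_or (M : ThetaErst Θ ar) [Nonempty M.carrier] {θ : Θ}
    {l : List M.carrier} (hl : l ∈ M.rel θ) :
    (∃ a, l = List.replicate (ar θ) a) ∨ (2 ≤ ar θ ∧ l.length = ar θ ∧ l.Pairwise (· < ·)) := by
  rcases Nat.eq_zero_or_pos (ar θ) with h | h
  · refine Or.inl ⟨Classical.arbitrary _, ?_⟩
    rw [h, List.replicate_zero, ← List.length_eq_zero_iff, M.len θ l hl, h]
  · exact (M.isErstTuple hl).cases h

theorem isSRQtheta_iff {M N : ThetaErst Θ ar} {f : M.carrier → N.carrier} :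
    IsSRQtheta M N f ↔ ∀ θ, (∀ l ∈ M.rel θ, l.map f ∈ N.rel θ) ∧
      ∀ y ∈ N.rel θ, ∃ x ∈ M.rel θ, x.map f = y ∧
        ∀ x' ∈ M.rel θ, tupleKey x' < tupleKey x → tupleKey (x'.map f) < tupleKey y := by
  refine forall_congr' fun θ => ?_
  rw [isRigidSurjOn_iff (kA := tupleKey) (kB := tupleKey)
    ((List.finite_length_eq M.carrier (ar θ)).subset fun l hl => M.len θ l hl)
    (fun a ha b hb h => tupleKey_injOn (M.isErstTuple ha) (M.isErstTuple hb) h)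
    (fun a ha b hb h => tupleKey_injOn (N.isErstTuple ha) (N.isErstTuple hb) h)
    (fun a ha b hb => salLT_iff_tupleKey_lt (M.isErstTuple ha) (M.isErstTuple hb))
    (fun a ha b hb => salLT_iff_tupleKey_lt (N.isErstTuple ha) (N.isErstTuple hb))]
  tauto

theorem isSRQtheta_id (M : ThetaErst Θ ar) : IsSRQtheta M M id :=
  isSRQtheta_iff.2 fun θ => ⟨fun l hl => by simpa using hl,
    fun y hy => ⟨y, hy, by simp, fun x' _ h => by simpa using h⟩⟩

theorem tupleKey_replicate_lt_replicate {X : Type*} [LinearOrder X] {n : ℕ} (hn : 0 < n)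
    {a b : X} : tupleKey (List.replicate n a) < tupleKey (List.replicate n b) ↔ a < b := by
  rw [tupleKey_lt_iff, card_toFinset_replicate hn, card_toFinset_replicate hn]
  simp [Finset.Colex.singleton_lt_singleton]

theorem tupleKey_replicate_lt {X : Type*} [LinearOrder X] {n : ℕ} (a : X) {l : List X}
    (h : 2 ≤ l.length) (hl : l.Pairwise (· < ·)) :
    tupleKey (List.replicate n a) < tupleKey l := by
  rw [tupleKey_lt_iff, card_toFinset_of_pairwise hl]
  left
  have : (List.replicate n a).toFinset ⊆ {a} := fun x hx => by
    simp at hx; simp [hx.2]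
  have := Finset.card_le_card this
  rw [Finset.card_singleton] at this
  omega

theorem tupleKey_lt_of_pairwise {X : Type*} [LinearOrder X] {l l' : List X}
    (hl : l.Pairwise (· < ·)) (hl' : l'.Pairwise (· < ·)) (h : l.length = l'.length) :
    tupleKey l < tupleKey l' ↔ toColex l.toFinset < toColex l'.toFinset := by
  rw [tupleKey_lt_iff, card_toFinset_of_pairwise hl, card_toFinset_of_pairwise hl', h]
  simp

/-! ### Coding the vertices and the tuples of an erst in one chain -/

/-- The sets of entries of the nonconstant tuples of `M.rel θ`. -/
def edges (M : ThetaErst Θ ar) (θ : Θ) : Finset (Finset M.carrier) :=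
  Finset.univ.filter fun S => 2 ≤ S.card ∧ S.sort ∈ M.rel θ

theorem mem_edges {M : ThetaErst Θ ar} {θ : Θ} {S : Finset M.carrier} :
    S ∈ edges M θ ↔ 2 ≤ S.card ∧ S.sort ∈ M.rel θ := by
  simp [edges]

theorem card_eq_of_mem_edges {M : ThetaErst Θ ar} {θ : Θ} {S : Finset M.carrier}
    (h : S ∈ edges M θ) : S.card = ar θ := by
  rw [← M.len θ _ (mem_edges.1 h).2, Finset.length_sort]

theorem toFinset_mem_edges {M : ThetaErst Θ ar} {θ : Θ} {l : List M.carrier}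
    (hl : l ∈ M.rel θ) (hp : l.Pairwise (· < ·)) (h : 2 ≤ l.length) : l.toFinset ∈ edges M θ := by
  rw [mem_edges, sort_toFinset_of_pairwise hp, card_toFinset_of_pairwise hp]
  exact ⟨h, hl⟩

/-- A labelled finite set; labels are compared first. -/
abbrev Code (K : ℕ) (X : Type) [LinearOrder X] := Fin (K + 1) ×ₗ Colex (Finset X)

/-- The label of a code. -/
def Code.label {K : ℕ} {X : Type} [LinearOrder X] (p : Code K X) : Fin (K + 1) := (ofLex p).1

/-- The underlying set of a code. -/
def Code.set {K : ℕ} {X : Type} [LinearOrder X] (p : Code K X) : Finset X := ofColex (ofLex p).2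

/-- The code with given label and set. -/
def Code.mk {K : ℕ} {X : Type} [LinearOrder X] (i : Fin (K + 1)) (S : Finset X) : Code K X :=
  toLex (i, toColex S)

section Code

variable {K : ℕ} {X Y : Type} [LinearOrder X] [LinearOrder Y]

@[simp] theorem Code.label_mk (i : Fin (K + 1)) (S : Finset X) : (Code.mk i S).label = i := rfl

@[simp] theorem Code.set_mk (i : Fin (K + 1)) (S : Finset X) : (Code.mk i S).set = S := rfl

theorem Code.mk_lt_mk {i j : Fin (K + 1)} {S T : Finset X} :
    Code.mk i S < Code.mk j T ↔ i < j ∨ i = j ∧ toColex S < toColex T :=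
  Prod.Lex.toLex_lt_toLex

/-- The image of a code; codes whose image is a single point receive the label `0`. -/
def Code.map (g : X → Y) (p : Code K X) : Code K Y :=
  Code.mk (if (p.set.image g).card = 1 then 0 else p.label) (p.set.image g)

theorem Code.map_mk_of_eq_one {g : X → Y} {j : Fin (K + 1)} {S : Finset X}
    (h : (S.image g).card = 1) : (Code.mk j S).map g = Code.mk 0 (S.image g) := by
  rw [Code.map]
  exact congrArg (Code.mk · (S.image g)) (if_pos h)

theorem Code.map_mk_of_ne_one {g : X → Y} {j : Fin (K + 1)} {S : Finset X}
    (h : (S.image g).card ≠ 1) : (Code.mk j S).map g = Code.mk j (S.image g) := by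
  rw [Code.map]
  exact congrArg (Code.mk · (S.image g)) (if_neg h)

/-- The entry in position `i` of the set of a code whose label is `c`; the first entry if there
is no such position or if the label is not `c`. -/
def Code.val (p : Code K X) (c : Fin (K + 1)) (i : ℕ) (d : X) : X :=
  p.set.sort.getD (if p.label = c ∧ i < p.set.card then i else 0) d

theorem Code.val_eq_getElem (p : Code K X) (hp : p.set.Nonempty) (c : Fin (K + 1)) (i : ℕ)
    (d : X) : ∃ h : (if p.label = c ∧ i < p.set.card then i else 0) < p.set.sort.length,
      p.val c i d = p.set.sort[if p.label = c ∧ i < p.set.card then i else 0] := by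
  have h : (if p.label = c ∧ i < p.set.card then i else 0) < p.set.sort.length := by
    rw [Finset.length_sort]
    split_ifs with h
    · exact h.2
    · exact hp.card_pos
  exact ⟨h, List.getD_eq_getElem _ _ h⟩

theorem Code.val_mem (p : Code K X) (hp : p.set.Nonempty) (c : Fin (K + 1)) (i : ℕ)
    (d : X) : p.val c i d ∈ p.set := by
  obtain ⟨h, e⟩ := p.val_eq_getElem hp c i d
  rw [e, ← Finset.mem_sort (· ≤ ·)]
  exact List.getElem_mem h

theorem Code.val_mk_singleton (j c : Fin (K + 1)) (a : X) (i : ℕ) (d : X) :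
    (Code.mk j {a}).val c i d = a := by
  simpa using (Code.mk j {a}).val_mem (by simp) c i d

theorem Code.map_val (g : X → Y) (p : Code K X) (hp : p.set.Nonempty)
    (h : (p.set.image g).card = 1 ∨ p.set.sort.map g = (p.set.image g).sort)
    (c : Fin (K + 1)) (i : ℕ) (d : X) (d' : Y) : g (p.val c i d) = (p.map g).val c i d' := by
  have h0 : (p.map g).set.Nonempty := hp.image g
  by_cases h1 : (p.set.image g).card = 1
  · obtain ⟨z, hz⟩ := Finset.card_eq_one.1 h1
    have e1 : g (p.val c i d) ∈ p.set.image g := Finset.mem_image_of_mem _ (p.val_mem hp c i d)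
    have e2 : (p.map g).val c i d' ∈ p.set.image g := (p.map g).val_mem h0 c i d'
    rw [hz, Finset.mem_singleton] at e1 e2
    rw [e1, e2]
  · have h2 := h.resolve_left h1
    have hcard : (p.set.image g).card = p.set.card := by
      rw [← Finset.length_sort (· ≤ ·), ← h2, List.length_map, Finset.length_sort]
    have hl : (p.map g).label = p.label := by simp [Code.map, h1]
    have hs : (p.map g).set = p.set.image g := rfl
    obtain ⟨h3, e3⟩ := p.val_eq_getElem hp c i d
    rw [e3, Code.val, hl, hs, hcard, ← h2, List.getD_eq_getElem _ _ (by simpa using h3),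
      List.getElem_map]

end Code

variable {K : ℕ} {lab : Θ → Fin (K + 1)}

/-- The codes of the vertices and of the nonconstant tuples of `M`. -/
def IsCode (lab : Θ → Fin (K + 1)) (M : ThetaErst Θ ar) (p : Code K M.carrier) : Prop :=
  (∃ a, p = Code.mk 0 {a}) ∨ ∃ θ, ∃ S ∈ edges M θ, p = Code.mk (lab θ) S

theorem IsCode.nonempty {M : ThetaErst Θ ar} {p : Code K M.carrier} (hp : IsCode lab M p) :
    p.set.Nonempty := by
  obtain ⟨a, rfl⟩ | ⟨θ, S, hS, rfl⟩ := hp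
  · simp
  · rw [Code.set_mk, ← Finset.card_pos]
    have := (mem_edges.1 hS).1
    omega

theorem IsCode.lt_mk_zero {M : ThetaErst Θ ar} (hlab : ∀ θ, 0 < lab θ) {p : Code K M.carrier}
    (hp : IsCode lab M p) {b : M.carrier} (h : p < Code.mk 0 {b}) :
    ∃ b' < b, p = Code.mk 0 {b'} := by
  obtain ⟨a, rfl⟩ | ⟨θ, S, hS, rfl⟩ := hp
  · rw [Code.mk_lt_mk] at h
    refine ⟨a, ?_, rfl⟩
    simpa [Finset.Colex.singleton_lt_singleton] using h
  · rw [Code.mk_lt_mk] at h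
    rcases h with h | ⟨h, -⟩
    · exact absurd h (hlab θ).le.not_gt
    · exact absurd h (hlab θ).ne'

theorem image_eq_toFinset_map {X Y : Type} [LinearOrder X] [LinearOrder Y] (g : X → Y)
    (S : Finset X) : S.image g = (S.sort.map g).toFinset := by
  ext y
  simp

/-- The image of the set of entries of a nonconstant tuple. -/
theorem IsSRQtheta.image_edge {M N : ThetaErst Θ ar} {g : M.carrier → N.carrier}
    (hg : IsSRQtheta M N g) {θ : Θ} {S : Finset M.carrier} (hS : S ∈ edges M θ) :
    (∃ a, S.image g = {a} ∧ S.sort.map g = List.replicate (ar θ) a) ∨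
      (S.image g ∈ edges N θ ∧ S.sort.map g = (S.image g).sort) := by
  have h2 := (mem_edges.1 hS).1
  have hr := (hg θ).1 _ (mem_edges.1 hS).2
  have hc := card_eq_of_mem_edges hS
  have : Nonempty N.carrier := by
    obtain ⟨x, -⟩ := Finset.card_pos.1 (show 0 < S.card by omega)
    exact ⟨g x⟩
  rw [image_eq_toFinset_map]
  rcases N.replicate_or hr with ⟨a, ha⟩ | ⟨h3, h4, h5⟩
  · exact Or.inl ⟨a, by rw [ha, card_toFinset_replicate (by omega)], ha⟩
  · exact Or.inr ⟨toFinset_mem_edges hr h5 (by omega), (sort_toFinset_of_pairwise h5).symm⟩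

theorem IsSRQtheta.isCode_map {M N : ThetaErst Θ ar} {g : M.carrier → N.carrier}
    (hg : IsSRQtheta M N g) {p : Code K M.carrier} (hp : IsCode lab M p) :
    IsCode lab N (p.map g) := by
  obtain ⟨a, rfl⟩ | ⟨θ, S, hS, rfl⟩ := hp
  · exact Or.inl ⟨g a, by simp [Code.map]⟩
  · rcases hg.image_edge hS with ⟨a, ha, -⟩ | ⟨h, -⟩
    · exact Or.inl ⟨a, by simp [Code.map, ha]⟩
    · refine Or.inr ⟨θ, _, h, ?_⟩
      have := (mem_edges.1 h).1
      exact Code.map_mk_of_ne_one (by omega)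

theorem IsSRQtheta.map_val {M N : ThetaErst Θ ar} {g : M.carrier → N.carrier}
    (hg : IsSRQtheta M N g) {p : Code K M.carrier} (hp : IsCode lab M p)
    (c : Fin (K + 1)) (i : ℕ) (d : M.carrier) (d' : N.carrier) :
    g (p.val c i d) = (p.map g).val c i d' := by
  refine p.map_val g hp.nonempty ?_ c i d d'
  obtain ⟨a, rfl⟩ | ⟨θ, S, hS, rfl⟩ := hp
  · simp
  · rcases hg.image_edge hS with ⟨a, ha, -⟩ | ⟨-, h⟩
    · exact Or.inl (by simp [ha])
    · exact Or.inr h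

theorem IsSRQtheta.exists_vertex {M N : ThetaErst Θ ar} {g : M.carrier → N.carrier}
    (hg : IsSRQtheta M N g) {θ : Θ} (hθ : 0 < ar θ) (a : N.carrier) :
    ∃ b, g b = a ∧ ∀ b' < b, g b' < a := by
  obtain ⟨x, hx, hxa, hmin⟩ := (isSRQtheta_iff.1 hg θ).2 _ (N.refl θ a)
  have hlen := M.len θ x hx
  have hmem : ∀ b ∈ x, g b = a := fun b hb =>
    (List.mem_replicate.1 (hxa ▸ List.mem_map_of_mem hb : g b ∈ List.replicate (ar θ) a)).2
  obtain ⟨b, hb⟩ := List.exists_mem_of_length_pos (hlen ▸ hθ : 0 < x.length)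
  have : Nonempty M.carrier := ⟨b⟩
  rcases M.replicate_or hx with ⟨b, rfl⟩ | ⟨h2, h3, h4⟩
  · refine ⟨b, hmem b (List.mem_replicate.2 ⟨hθ.ne', rfl⟩), fun b' hb' => ?_⟩
    have := hmin _ (M.refl θ b') ((tupleKey_replicate_lt_replicate hθ).2 hb')
    rwa [List.map_replicate, tupleKey_replicate_lt_replicate hθ] at this
  · have := hmin _ (M.refl θ b) (tupleKey_replicate_lt b (by omega) h4)
    rw [List.map_replicate, hmem b hb] at this
    exact absurd this (lt_irrefl _)

theorem IsSRQtheta.exists_code {M N : ThetaErst Θ ar} {g : M.carrier → N.carrier}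
    (hg : IsSRQtheta M N g) {θ₀ : Θ} (hθ₀ : 0 < ar θ₀) (hlab : ∀ θ, 0 < lab θ)
    (hM : ∀ θ θ', lab θ = lab θ' → edges M θ = edges M θ') {y : Code K N.carrier}
    (hy : IsCode lab N y) :
    ∃ x, IsCode lab M x ∧ x.map g = y ∧ ∀ x', IsCode lab M x' → x' < x → x'.map g < y := by
  obtain ⟨a, rfl⟩ | ⟨θ, S, hS, rfl⟩ := hy
  · obtain ⟨b, rfl, hb⟩ := hg.exists_vertex hθ₀ a
    refine ⟨Code.mk 0 {b}, Or.inl ⟨b, rfl⟩, by simp [Code.map], fun x' hx' hlt => ?_⟩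
    obtain ⟨b', hb', rfl⟩ := hx'.lt_mk_zero hlab hlt
    simp only [Code.map, Code.set_mk, Finset.image_singleton, Code.mk_lt_mk]
    right
    simpa [Finset.Colex.singleton_lt_singleton] using hb b' hb'
  · obtain ⟨h2, hSr⟩ := mem_edges.1 hS
    have hSc := card_eq_of_mem_edges hS
    have hSp : S.sort.Pairwise (· < ·) := List.sortedLT_iff_pairwise.1 S.sortedLT_sort
    obtain ⟨x, hx, hxS, hmin⟩ := (isSRQtheta_iff.1 hg θ).2 _ hSr
    have hlen := M.len θ x hx
    obtain ⟨b, hb⟩ := List.exists_mem_of_length_pos (show 0 < x.length by omega)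
    have : Nonempty M.carrier := ⟨b⟩
    have himg : x.toFinset.image g = S := by
      have := congrArg List.toFinset hxS
      rw [Finset.sort_toFinset] at this
      rw [← this]
      ext; simp
    rcases M.replicate_or hx with ⟨b, rfl⟩ | ⟨-, -, hp⟩
    · rw [card_toFinset_replicate (by omega), Finset.image_singleton] at himg
      rw [← himg, Finset.card_singleton] at h2
      omega
    · refine ⟨Code.mk (lab θ) x.toFinset,
        Or.inr ⟨θ, _, toFinset_mem_edges hx hp (by omega), rfl⟩, ?_, fun x' hx' hlt => ?_⟩
      · rw [Code.map_mk_of_ne_one (by rw [himg]; omega), himg]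
      · obtain ⟨a, rfl⟩ | ⟨θ', S', hS', rfl⟩ := hx'
        · simp only [Code.map, Code.set_mk, Finset.image_singleton, Code.mk_lt_mk]
          simp [hlab θ]
        · rw [Code.mk_lt_mk] at hlt
          by_cases h1 : (S'.image g).card = 1
          · rw [Code.map_mk_of_eq_one h1, Code.mk_lt_mk]
            exact Or.inl (hlab θ)
          rw [Code.map_mk_of_ne_one h1, Code.mk_lt_mk]
          rcases hlt with hlt | ⟨he, hlt⟩
          · exact Or.inl hlt
          · refine Or.inr ⟨he, ?_⟩
            rw [hM _ _ he] at hS'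
            have hSp' : S'.sort.Pairwise (· < ·) :=
              List.sortedLT_iff_pairwise.1 S'.sortedLT_sort
            have hlt' := hmin _ (mem_edges.1 hS').2
              ((tupleKey_lt_of_pairwise hSp' hp
                (by rw [Finset.length_sort, card_eq_of_mem_edges hS', hlen])).2
                (by rwa [Finset.sort_toFinset]))
            rcases hg.image_edge hS' with ⟨a, ha, -⟩ | ⟨h3, h4⟩
            · simp [ha] at h1
            · rw [h4, tupleKey_lt_of_pairwise
                (List.sortedLT_iff_pairwise.1 (Finset.sortedLT_sort _)) hSp
                (by rw [Finset.length_sort, Finset.length_sort, hSc, card_eq_of_mem_edges h3]),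
                Finset.sort_toFinset, Finset.sort_toFinset] at hlt'
              exact hlt'

/-- The increasing enumeration of a finite subset of a chain and its inverse. -/
theorem exists_enumeration {α : Type*} [LinearOrder α] [Inhabited α] (T : Finset α) :
    ∃ (en : ℕ → α) (rk : α → ℕ), (∀ j < T.card, en j ∈ T ∧ rk (en j) = j) ∧
      (∀ x ∈ T, rk x < T.card ∧ en (rk x) = x) ∧
      ∀ x ∈ T, ∀ y ∈ T, rk x < rk y ↔ x < y := by
  have hn : T.sort.Nodup := Finset.sort_nodup T _
  have hlen : T.sort.length = T.card := Finset.length_sort _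
  have hs : ∀ i (hi : i < T.sort.length) j (hj : j < T.sort.length),
      i < j ↔ T.sort[i] < T.sort[j] := fun i hi j hj =>
    (List.sortedLT_iff_strictMono_get.1 T.sortedLT_sort).lt_iff_lt
      (a := ⟨i, hi⟩) (b := ⟨j, hj⟩) |>.symm
  have hrk : ∀ x ∈ T, T.sort.idxOf x < T.sort.length := fun x hx =>
    List.idxOf_lt_length_iff.2 (by simpa using hx)
  refine ⟨fun j => T.sort.getD j default, fun x => T.sort.idxOf x, fun j hj => ?_,
    fun x hx => ?_, fun x hx y hy => ?_⟩
  · rw [← hlen] at hj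
    simp only [List.getD_eq_getElem _ _ hj]
    exact ⟨(Finset.mem_sort (· ≤ ·)).1 (List.getElem_mem hj), hn.idxOf_getElem j hj⟩
  · simp only [List.getD_eq_getElem _ _ (hrk x hx)]
    exact ⟨hlen ▸ hrk x hx, List.getElem_idxOf (hrk x hx)⟩
  · simp only [hs _ (hrk x hx) _ (hrk y hy), List.getElem_idxOf]

/-! ### Blow-ups -/

/-- The vertices of a blow-up. -/
abbrev BlowUpVertex (n K m : ℕ) := Fin n ×ₗ (Fin (K + 1) ×ₗ Fin (m + 1))

/-- The vertex with given coordinates. -/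
def BlowUpVertex.mk {n K m : ℕ} (c : Fin n) (j : Fin (K + 1)) (i : Fin (m + 1)) :
    BlowUpVertex n K m := toLex (c, toLex (j, i))

theorem BlowUpVertex.mk_lt_mk {n K m : ℕ} {c c' : Fin n} {j j' : Fin (K + 1)}
    {i i' : Fin (m + 1)} : BlowUpVertex.mk c j i < BlowUpVertex.mk c' j' i' ↔
      c < c' ∨ c = c' ∧ (j < j' ∨ j = j' ∧ i < i') := by
  simp [BlowUpVertex.mk, Prod.Lex.toLex_lt_toLex]

/-- The first `r` vertices with given first two coordinates. -/
def block {n K : ℕ} (m r : ℕ) (c : Fin n) (j : Fin (K + 1)) : List (BlowUpVertex n K m) :=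
  ((List.finRange (m + 1)).take r).map (BlowUpVertex.mk c j)

theorem length_block {n K m r : ℕ} (hr : r ≤ m + 1) (c : Fin n) (j : Fin (K + 1)) :
    (block m r c j).length = r := by
  simp [block, hr]

theorem pairwise_block {n K m r : ℕ} (c : Fin n) (j : Fin (K + 1)) :
    (block m r c j).Pairwise (· < ·) := by
  rw [block, List.pairwise_map]
  refine List.Pairwise.imp (fun {a b} hab => ?_)
    (List.Pairwise.sublist (List.take_sublist _ _) (List.pairwise_lt_finRange (m + 1)))
  rw [BlowUpVertex.mk_lt_mk]
  exact Or.inr ⟨rfl, Or.inr ⟨rfl, hab⟩⟩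

theorem mem_block {n K m r : ℕ} {c : Fin n} {j : Fin (K + 1)} {v : BlowUpVertex n K m}
    (hv : v ∈ block m r c j) : ∃ i, v = BlowUpVertex.mk c j i := by
  obtain ⟨i, -, rfl⟩ := List.mem_map.1 hv
  exact ⟨i, rfl⟩

theorem lt_of_tupleKey_block_lt {n K m r : ℕ} {c c' : Fin n} {j : Fin (K + 1)}
    (hr : r ≤ m + 1) (hr' : 0 < r)
    (h : tupleKey (block m r c j) < tupleKey (block m r c' j)) : c < c' := by
  by_contra hc
  rcases (not_lt.1 hc).eq_or_lt with rfl | hc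
  · exact lt_irrefl _ h
  refine lt_asymm h ((tupleKey_lt_of_pairwise (pairwise_block _ _) (pairwise_block _ _)
    (by rw [length_block hr, length_block hr])).2 ?_)
  rw [Finset.Colex.toColex_lt_toColex_iff_exists_forall_lt]
  obtain ⟨v, hv⟩ := List.exists_mem_of_length_pos
    (show 0 < (block m r c j).length by rwa [length_block hr])
  have hlt : ∀ b ∈ block m r c' j, ∀ b' ∈ block m r c j, b < b' := by
    intro b hb b' hb'
    obtain ⟨i, rfl⟩ := mem_block hb
    obtain ⟨i', rfl⟩ := mem_block hb'
    rw [BlowUpVertex.mk_lt_mk]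
    exact Or.inl hc
  refine ⟨v, by simpa using hv, fun hv' => ?_, fun b hb _ => hlt b (by simpa using hb) v hv⟩
  exact lt_irrefl _ (hlt v (by simpa using hv') v hv)

/-- The relations of a blow-up: there is one nonconstant tuple for each `θ` with
`2 ≤ ar θ ≤ m + 1` and each `c : Fin n`. -/
def blowUpRel (lab : Θ → Fin (K + 1)) (ar : Θ → ℕ) (n m : ℕ) (θ : Θ) :
    Set (List (BlowUpVertex n K m)) :=
  {l | (∃ v, l = List.replicate (ar θ) v) ∨
    ∃ c, 2 ≤ ar θ ∧ ar θ ≤ m + 1 ∧ l = block m (ar θ) c (lab θ)}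

/-- The erst on `BlowUpVertex n K m` with the relations `blowUpRel lab ar n m`. -/
def blowUp (lab : Θ → Fin (K + 1)) (ar : Θ → ℕ) (n m : ℕ) : ThetaErst Θ ar where
  carrier := BlowUpVertex n K m
  fintypeI := Fintype.ofFinite (Fin n × (Fin (K + 1) × Fin (m + 1)))
  linearOrderI := inferInstance
  rel := blowUpRel lab ar n m
  len θ l hl := by
    obtain ⟨v, rfl⟩ | ⟨c, -, h, rfl⟩ := hl
    · simp
    · exact length_block h _ _
  refl θ v := Or.inl ⟨v, rfl⟩
  ext θ l hl := by
    obtain ⟨v, rfl⟩ | ⟨c, -, h, rfl⟩ := hl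
    · exact Or.inl ⟨v, rfl⟩
    · exact Or.inr (List.isChain_iff_pairwise.2 (pairwise_block _ _))

/-- The vertex map of a blow-up given by a sequence of codes. -/
def blowUpMap {n m : ℕ} {X : Type} [LinearOrder X] (u : ℕ → Code K X) (d : X)
    (v : BlowUpVertex n K m) : X :=
  (u (ofLex v).1).val (ofLex (ofLex v).2).1 (ofLex (ofLex v).2).2 d

theorem map_block_of_edge {n m : ℕ} {M : ThetaErst Θ ar} (u : ℕ → Code K M.carrier)
    (d : M.carrier) (c : Fin n) {θ : Θ} (hθ : ar θ ≤ m + 1) {S : Finset M.carrier}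
    (hS : S ∈ edges M θ) (he : u c = Code.mk (lab θ) S) :
    (block m (ar θ) c (lab θ)).map (blowUpMap u d) = S.sort := by
  have hc := card_eq_of_mem_edges hS
  refine List.ext_getElem ?_ fun i h1 h2 => ?_
  · rw [List.length_map, length_block hθ, Finset.length_sort, hc]
  · have h3 : i < S.card := by rwa [Finset.length_sort] at h2
    have h4 : (block m (ar θ) c (lab θ)).map (blowUpMap u d) =
        ((List.finRange (m + 1)).take (ar θ)).map
          (fun i : Fin (m + 1) => (Code.mk (lab θ) S).val (lab θ) i d) := by
      rw [block, List.map_map, ← he]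
      rfl
    simp only [h4, List.getElem_map, List.getElem_take, List.getElem_finRange]
    simp [Code.val, h3]

theorem map_block {n m : ℕ} {M : ThetaErst Θ ar}
    (hM : ∀ θ θ', lab θ = lab θ' → edges M θ = edges M θ') (hlab : ∀ θ, 0 < lab θ)
    (u : ℕ → Code K M.carrier) (d : M.carrier) (c : Fin n) (hu : IsCode lab M (u c)) (θ : Θ)
    (hθ : ar θ ≤ m + 1) :
    (∃ S ∈ edges M θ, u c = Code.mk (lab θ) S ∧
      (block m (ar θ) c (lab θ)).map (blowUpMap u d) = S.sort) ∨
    ∃ a, (block m (ar θ) c (lab θ)).map (blowUpMap u d) = List.replicate (ar θ) a := by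
  by_cases h : ∃ S ∈ edges M θ, u c = Code.mk (lab θ) S
  · obtain ⟨S, hS, he⟩ := h
    exact Or.inl ⟨S, hS, he, map_block_of_edge u d c hθ hS he⟩
  · right
    refine ⟨(u c).val (lab θ) 0 d, List.eq_replicate_iff.2
      ⟨by rw [List.length_map, length_block hθ], fun b hb => ?_⟩⟩
    obtain ⟨v, hv, rfl⟩ := List.mem_map.1 hb
    obtain ⟨i, rfl⟩ := mem_block hv
    change (u c).val (lab θ) i d = _
    have hne : (u c).label ≠ lab θ := by
      intro hl
      obtain ⟨a, ha⟩ | ⟨θ', S, hS, hS'⟩ := hu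
      · rw [ha, Code.label_mk] at hl
        exact (hlab θ).ne hl
      · rw [hS', Code.label_mk] at hl
        exact h ⟨S, hM _ _ hl ▸ hS, hl ▸ hS'⟩
    simp [Code.val, hne]

theorem blowUpMap_rigid {n m : ℕ} {M : ThetaErst Θ ar} (hm : Fintype.card M.carrier ≤ m + 1)
    (hM : ∀ θ θ', lab θ = lab θ' → edges M θ = edges M θ') (hlab : ∀ θ, 0 < lab θ)
    (u : ℕ → Code K M.carrier) (d : M.carrier) (hu : ∀ c < n, IsCode lab M (u c))
    (hex : ∀ y, IsCode lab M y → ∃ c < n, u c = y ∧ ∀ c' < c, u c' < y) :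
    ∀ θ, (∀ l ∈ blowUpRel lab ar n m θ, l.map (blowUpMap u d) ∈ M.rel θ) ∧
      ∀ y ∈ M.rel θ, ∃ x ∈ blowUpRel lab ar n m θ, x.map (blowUpMap u d) = y ∧
        ∀ x' ∈ blowUpRel lab ar n m θ, tupleKey x' < tupleKey x →
          tupleKey (x'.map (blowUpMap u d)) < tupleKey y := by
  intro θ
  constructor
  · rintro l (⟨v, rfl⟩ | ⟨c, -, hc, rfl⟩)
    · rw [List.map_replicate]
      exact M.refl θ _
    · rcases map_block hM hlab u d c (hu c c.2) θ hc with ⟨S, hS, -, h⟩ | ⟨a, h⟩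
      · rw [h]
        exact (mem_edges.1 hS).2
      · rw [h]
        exact M.refl θ a
  intro y hy
  have : Nonempty M.carrier := ⟨d⟩
  rcases M.replicate_or hy with ⟨b, rfl⟩ | ⟨h2, h3, h4⟩
  · obtain ⟨c, hcn, hc, hmin⟩ := hex (Code.mk 0 {b}) (Or.inl ⟨b, rfl⟩)
    have hφ : blowUpMap (m := m) u d (BlowUpVertex.mk (⟨c, hcn⟩ : Fin n) 0 0) = b := by
      change (u c).val _ _ d = b
      rw [hc, Code.val_mk_singleton]
    refine ⟨_, Or.inl ⟨BlowUpVertex.mk ⟨c, hcn⟩ 0 0, rfl⟩, ?_, ?_⟩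
    · rw [List.map_replicate, hφ]
    rintro x' (⟨v, rfl⟩ | ⟨c', h5, h6, rfl⟩) hlt
    · rcases Nat.eq_zero_or_pos (ar θ) with h0 | h0
      · rw [h0] at hlt
        exact absurd hlt (lt_irrefl _)
      rw [tupleKey_replicate_lt_replicate h0] at hlt
      rw [List.map_replicate, tupleKey_replicate_lt_replicate h0]
      change BlowUpVertex.mk (ofLex v).1 (ofLex (ofLex v).2).1 (ofLex (ofLex v).2).2 < _ at hlt
      rw [BlowUpVertex.mk_lt_mk] at hlt
      have hlt' : (ofLex v).1 < (⟨c, hcn⟩ : Fin n) := by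
        rcases hlt with h | ⟨-, h | ⟨-, h⟩⟩
        · exact h
        · exact absurd h (Fin.not_lt_zero _)
        · exact absurd h (Fin.not_lt_zero _)
      obtain ⟨b', hb', he⟩ := (hu _ (ofLex v).1.2).lt_mk_zero hlab (hmin _ hlt')
      change (u _).val _ _ d < b
      rwa [he, Code.val_mk_singleton]
    · exact absurd hlt (tupleKey_replicate_lt _ (by rwa [length_block h6])
        (pairwise_block _ _)).asymm
  · have hS := toFinset_mem_edges hy h4 (by omega)
    have hsort := sort_toFinset_of_pairwise h4
    obtain ⟨c, hcn, hc, hmin⟩ := hex (Code.mk (lab θ) y.toFinset) (Or.inr ⟨θ, _, hS, rfl⟩)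
    have hθ : ar θ ≤ m + 1 := by
      rw [← card_eq_of_mem_edges hS]
      exact (Finset.card_le_univ _).trans hm
    refine ⟨block m (ar θ) ⟨c, hcn⟩ (lab θ), Or.inr ⟨_, h2, hθ, rfl⟩, ?_, ?_⟩
    · rw [map_block_of_edge u d ⟨c, hcn⟩ hθ hS hc, hsort]
    · rintro x' (⟨v, rfl⟩ | ⟨c', -, -, rfl⟩) hlt
      · rw [List.map_replicate]
        exact tupleKey_replicate_lt _ (by omega) h4
      · have hcc := lt_of_tupleKey_block_lt hθ (by omega) hlt
        have hlt' := hmin _ hcc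
        rcases map_block hM hlab u d c' (hu c' c'.2) θ hθ with ⟨S, hS', he, h⟩ | ⟨a, h⟩
        · rw [h]
          rw [he, Code.mk_lt_mk] at hlt'
          refine (tupleKey_lt_of_pairwise (List.sortedLT_iff_pairwise.1 S.sortedLT_sort) h4
            (by rw [Finset.length_sort, card_eq_of_mem_edges hS', h3])).2 ?_
          rw [Finset.sort_toFinset]
          exact (hlt'.resolve_left (lt_irrefl _)).2
        · rw [h]
          exact tupleKey_replicate_lt _ (by omega) h4

theorem isSRQtheta_blowUpMap {n m : ℕ} {M : ThetaErst Θ ar} (hm : Fintype.card M.carrier ≤ m + 1)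
    (hM : ∀ θ θ', lab θ = lab θ' → edges M θ = edges M θ') (hlab : ∀ θ, 0 < lab θ)
    (u : ℕ → Code K M.carrier) (d : M.carrier) (hu : ∀ c < n, IsCode lab M (u c))
    (hex : ∀ y, IsCode lab M y → ∃ c < n, u c = y ∧ ∀ c' < c, u c' < y) :
    IsSRQtheta (blowUp lab ar n m) M (blowUpMap u d) :=
  isSRQtheta_iff.2 (blowUpMap_rigid hm hM hlab u d hu hex)

theorem isParamWord_of_enumerations {Y Z : Type} [LinearOrder Y] [LinearOrder Z]
    {S : Finset Y} {T : Finset Z} {enS : ℕ → Y} {rkS : Y → ℕ} {enT : ℕ → Z} {rkT : Z → ℕ}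
    (hS : ∀ j < S.card, enS j ∈ S ∧ rkS (enS j) = j)
    (hS' : ∀ x ∈ S, rkS x < S.card ∧ enS (rkS x) = x)
    (hSlt : ∀ x ∈ S, ∀ y ∈ S, rkS x < rkS y ↔ x < y)
    (hT : ∀ j < T.card, enT j ∈ T ∧ rkT (enT j) = j)
    (hT' : ∀ x ∈ T, rkT x < T.card ∧ enT (rkT x) = x)
    (hTlt : ∀ x ∈ T, ∀ y ∈ T, rkT x < rkT y ↔ x < y) {h : Y → Z} (hmap : ∀ x ∈ S, h x ∈ T)
    (hrigid : ∀ y ∈ T, ∃ x ∈ S, h x = y ∧ ∀ x' ∈ S, x' < x → h x' < y) :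
    IsParamWord 0 ((List.range S.card).map fun j => rkT (h (enS j))) T.card := by
  rw [isParamWord_iff]
  constructor
  · intro x hx
    obtain ⟨j, hj, rfl⟩ := List.mem_map.1 hx
    rw [Nat.zero_add]
    exact (hT' _ (hmap _ (hS j (List.mem_range.1 hj)).1)).1
  · intro i _ hi
    rw [Nat.zero_add] at hi
    obtain ⟨x, hx, hxy, hmin⟩ := hrigid _ (hT i hi).1
    refine ⟨rkS x, by simpa using (hS' x hx).1, ?_, fun j' hj' => ?_⟩
    · simp only [List.getElem_map, List.getElem_range]
      rw [(hS' x hx).2, hxy, (hT i hi).2]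
    · have hj'' := hS j' (hj'.trans (hS' x hx).1)
      simp only [List.getElem_map, List.getElem_range]
      rw [← (hT i hi).2, hTlt _ (hmap _ hj''.1) _ (hT i hi).1]
      refine hmin _ hj''.1 ((hSlt _ hj''.1 _ hx).1 ?_)
      rwa [hj''.2]

/-- The dual Ramsey property for ersts `A` and `B` with a labelling of the symbols which
determines the nonconstant tuples of `B`. -/
theorem exists_blowUp_ramsey {k : ℕ} {A B : ThetaErst Θ ar} (dA : A.carrier) (dB : B.carrier)
    {θ₀ : Θ} (hθ₀ : 0 < ar θ₀) (hlab : ∀ θ, 0 < lab θ)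
    (hB : ∀ θ θ', lab θ = lab θ' → edges B θ = edges B θ') :
    ∃ n, ∀ χ : ((blowUp lab ar n (Fintype.card B.carrier)).carrier → A.carrier) → Fin k,
      ∃ w : (blowUp lab ar n (Fintype.card B.carrier)).carrier → B.carrier,
        IsSRQtheta (blowUp lab ar n (Fintype.card B.carrier)) B w ∧
        ∃ i : Fin k, ∀ g : B.carrier → A.carrier, IsSRQtheta B A g → χ (g ∘ w) = i := by
  have : Finite (Code K A.carrier) :=
    inferInstanceAs (Finite (Fin (K + 1) × Finset A.carrier))
  have : Finite (Code K B.carrier) :=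
    inferInstanceAs (Finite (Fin (K + 1) × Finset B.carrier))
  have := Fintype.ofFinite (Code K A.carrier)
  have := Fintype.ofFinite (Code K B.carrier)
  have : Inhabited (Code K A.carrier) := ⟨Code.mk 0 ∅⟩
  have : Inhabited (Code K B.carrier) := ⟨Code.mk 0 ∅⟩
  obtain ⟨TA, hTA⟩ : ∃ T : Finset (Code K A.carrier), ∀ p, p ∈ T ↔ IsCode lab A p :=
    ⟨Finset.univ.filter (IsCode lab A), by simp⟩
  obtain ⟨TB, hTB⟩ : ∃ T : Finset (Code K B.carrier), ∀ p, p ∈ T ↔ IsCode lab B p :=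
    ⟨Finset.univ.filter (IsCode lab B), by simp⟩
  obtain ⟨enA, rkA, hA1, hA2, hA3⟩ := exists_enumeration TA
  obtain ⟨enB, rkB, hB1, hB2, hB3⟩ := exists_enumeration TB
  have hposA : 0 < TA.card := Finset.card_pos.2 ⟨_, (hTA _).2 (Or.inl ⟨dA, rfl⟩)⟩
  have hposB : 0 < TB.card := Finset.card_pos.2 ⟨_, (hTB _).2 (Or.inl ⟨dB, rfl⟩)⟩
  obtain ⟨n, hn⟩ := finite_dual_ramsey (Fin k) TB.card TA.card hposB hposA
  refine ⟨n, fun χ => ?_⟩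
  obtain ⟨F, hFn, hF, i, hi⟩ := hn fun v => χ (blowUpMap (fun c => enA (v.getD c 0)) dA)
  obtain ⟨hFlt, hFex⟩ := isParamWord_iff.1 hF
  rw [Nat.zero_add] at hFlt
  have hget : ∀ c (hc : c < n), F.getD c 0 = F[c]'(hFn ▸ hc) := fun c hc =>
    List.getD_eq_getElem _ _ (hFn ▸ hc)
  have hFc : ∀ c < n, F.getD c 0 < TB.card := fun c hc => by
    rw [hget c hc]
    exact hFlt _ (List.getElem_mem _)
  refine ⟨blowUpMap (fun c => enB (F.getD c 0)) dB, isSRQtheta_blowUpMap (Nat.le_succ _) hB hlab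
    _ dB (fun c hc => (hTB _).1 (hB1 _ (hFc c hc)).1) (fun y hy => ?_), i, fun g hg => ?_⟩
  · have hy' := (hTB y).2 hy
    obtain ⟨c, hc, hcy, hmin⟩ := hFex (rkB y) (Nat.zero_le _)
      (by rw [Nat.zero_add]; exact (hB2 y hy').1)
    have hcn : c < n := hFn ▸ hc
    refine ⟨c, hcn, ?_, fun c' hc' => ?_⟩
    · rw [hget c hcn, hcy, (hB2 y hy').2]
    · have h1 := hB1 _ (hFc c' (hc'.trans hcn))
      change enB (F.getD c' 0) < y
      rw [← hB3 _ h1.1 _ hy', h1.2, hget c' (hc'.trans hcn)]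
      exact hmin c' hc'
  · have hG := isParamWord_of_enumerations hB1 hB2 hB3 hA1 hA2 hA3 (h := Code.map g)
      (fun x hx => (hTA _).2 (hg.isCode_map ((hTB x).1 hx)))
      (fun y hy => by
        obtain ⟨x, hx, hxy, hmin⟩ := hg.exists_code hθ₀ hlab hB ((hTA y).1 hy)
        exact ⟨x, (hTB x).2 hx, hxy, fun x' hx' => hmin x' ((hTB x').1 hx')⟩)
    have key : ∀ c < n, enA ((F.map (wordSubst 0
        ((List.range TB.card).map fun j => rkA ((enB j).map g)))).getD c 0) =
        (enB (F.getD c 0)).map g := by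
      intro c hc
      have h0 := wordSubst_add (t := 0)
        (g := (List.range TB.card).map fun j => rkA ((enB j).map g)) (i := F.getD c 0)
        (by simpa using hFc c hc)
      rw [Nat.zero_add] at h0
      rw [List.getD_eq_getElem _ _ (by simpa [hFn] using hc), List.getElem_map, ← hget c hc, h0,
        List.getElem_map, List.getElem_range]
      exact (hA2 _ ((hTA _).2 (hg.isCode_map ((hTB _).1 (hB1 _ (hFc c hc)).1)))).2
    rw [← hi _ hG (by simp)]
    congr 1
    funext v
    have hv : (ofLex v).1.1 < n := (ofLex v).1.2
    change g ((enB (F.getD (ofLex v).1 0)).val _ _ dB) = (enA _).val _ _ dA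
    rw [hg.map_val ((hTB _).1 (hB1 _ (hFc _ hv)).1) _ _ _ dA]
    congr 1
    exact (key _ hv).symm

/-- Finitely many positive labels suffice to determine the nonconstant tuples of an erst. -/
theorem exists_labels (M : ThetaErst Θ ar) : ∃ (K : ℕ) (lab : Θ → Fin (K + 1)),
    (∀ θ, 0 < lab θ) ∧ ∀ θ θ', lab θ = lab θ' → edges M θ = edges M θ' :=
  ⟨_, fun θ => (Fintype.equivFin (Finset (Finset M.carrier)) (edges M θ)).succ,
    fun _ => Fin.succ_pos _,
    fun _ _ h => (Fintype.equivFin _).injective (Fin.succ_injective _ h)⟩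

/-- The restriction of an erst to the empty set of vertices. -/
def emptyErst (M : ThetaErst Θ ar) (h : ∀ θ, ar θ = 0) : ThetaErst Θ ar where
  carrier := Empty
  rel θ := {l | l = [] ∧ [] ∈ M.rel θ}
  len θ l hl := by rw [hl.1, h θ, List.length_nil]
  refl θ a := a.elim
  ext θ l hl := Or.inr (by rw [hl.1]; exact List.isChain_nil)

/-- Proposition 6.4. For every relational language `Θ` (with
`⊏ ∉ Θ`), the category `ERst_srq(Θ,⊏)` of all finite `Θ`-ersts and strong rigid
quotient maps has the dual Ramsey property. -/
theorem stmt16 (Θ : Type) (ar : Θ → ℕ) :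
    HasDualRamseyClass (fun M : ThetaErst Θ ar => M.carrier) IsSRQtheta := by
  rintro k - A - B - ⟨f, hf⟩
  by_cases h0 : ∀ θ, ar θ = 0
  · have he : IsEmpty (emptyErst B h0).carrier := inferInstanceAs (IsEmpty Empty)
    refine ⟨emptyErst B h0, trivial, fun χ => ⟨fun x => he.elim x, ?_, χ fun x => he.elim x,
      fun g _ => congrArg χ (funext fun x => he.elim x)⟩⟩
    refine isSRQtheta_iff.2 fun θ => ⟨?_, fun y hy => ?_⟩
    · rintro l ⟨rfl, hl⟩
      exact hl
    · obtain rfl : y = [] := List.length_eq_zero_iff.1 ((B.len θ y hy).trans (h0 θ))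
      refine ⟨[], ⟨rfl, hy⟩, rfl, ?_⟩
      rintro x' ⟨rfl, -⟩ hlt
      exact absurd hlt (lt_irrefl _)
  · push Not at h0
    obtain ⟨θ₀, hθ₀⟩ := h0
    rcases isEmpty_or_nonempty A.carrier with hA | ⟨⟨dA⟩⟩
    · exact ⟨B, trivial, fun χ => ⟨id, isSRQtheta_id B, χ f, fun g _ =>
        congrArg χ (funext fun x => hA.elim (f x))⟩⟩
    · obtain ⟨dB, -⟩ := hf.exists_vertex (Nat.pos_of_ne_zero hθ₀) dA
      obtain ⟨K, lab, hlab, hB⟩ := exists_labels B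
      obtain ⟨n, hn⟩ := exists_blowUp_ramsey (k := k) dA dB (Nat.pos_of_ne_zero hθ₀) hlab hB
      exact ⟨_, trivial, hn⟩
end
end

section
/- Let T be the category whose objects are finite linearly ordered reflexive tournaments and whose morphisms are rigid surjective homomorphisms. Then T does not have the dual Ramsey property. -/
open scoped Classical

noncomputable section

/-- A finite linearly ordered reflexive tournament. -/
structure OTourObj where
  carrier : Type
  [fintypeI : Fintype carrier]
  [linearOrderI : LinearOrder carrier]
  rel : carrier → carrier → Prop
  refl : ∀ x, rel x x
  total : ∀ x y : carrier, x ≠ y → rel x y ∨ rel y x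
  asymm : ∀ x y : carrier, x ≠ y → ¬(rel x y ∧ rel y x)

attribute [instance] OTourObj.fintypeI OTourObj.linearOrderI

/-- Rigid surjective homomorphisms: the morphisms of the category `T` of finite
linearly ordered reflexive tournaments. -/
def IsRSHtour (M N : OTourObj) (f : M.carrier → N.carrier) : Prop :=
  (∀ x y, M.rel x y → N.rel (f x) (f y)) ∧ IsRigidSurjection f

/-- A surjective monotone map between chains is a rigid surjection. -/
theorem isRigidSurjection_of_monotone {A B : Type*} [LinearOrder A] [LinearOrder B] {f : A → B}
    (hf : Monotone f) (hs : Function.Surjective f) : IsRigidSurjection f := by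
  refine ⟨hs, fun x y hxy a b ha hb => ?_⟩
  have hax : f a = x := ha.1
  have hby : f b = y := hb.1
  exact hf.reflect_lt (by rwa [hax, hby])

/-- The tournament `0 → 1` with the natural order. -/
def twoChain : OTourObj where
  carrier := Fin 2
  rel x y := x ≤ y
  refl := by decide
  total := by decide
  asymm := by decide

/-- The tournament on `{0, …, 4}` in which the cycle `0 → 1 → 2 → 0` dominates `3`, and everything
else dominates `4`. -/
abbrev cycleThenTwoRel (x y : Fin 5) : Prop :=
  x = y ∨ (x < y ∧ ¬ (x = 0 ∧ y = 2)) ∨ (x = 2 ∧ y = 0)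

/-- The tournament `cycleThenTwoRel` with the natural order. -/
def cycleThenTwo : OTourObj where
  carrier := Fin 5
  rel := cycleThenTwoRel
  refl := by decide
  total := by decide
  asymm := by decide

/-- The map `{0, …, 4} → {0, 1}` sending exactly the elements up to `t` to `0`. -/
abbrev cutAt (t x : Fin 5) : Fin 2 :=
  if x ≤ t then 0 else 1

theorem cutAt_eq_zero_iff {t x : Fin 5} : cutAt t x = 0 ↔ x ≤ t := by
  simp

theorem isRSHtour_cutAt {t : Fin 5} (h₂ : 2 ≤ t) (h₄ : t < 4) :
    IsRSHtour cycleThenTwo twoChain (cutAt t) := by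
  have hhom : ∀ x y : Fin 5, cycleThenTwoRel x y → cutAt t x ≤ cutAt t y := by
    revert t
    decide
  have hmono : ∀ x y : Fin 5, x ≤ y → cutAt t x ≤ cutAt t y := by
    revert t
    decide
  have hsurj : ∀ y : Fin 2, ∃ x : Fin 5, cutAt t x = y := by
    revert t
    decide
  exact ⟨hhom, isRigidSurjection_of_monotone (A := Fin 5) (B := Fin 2) (fun x y => hmono x y) hsurj⟩

/-- The subtournament `D` is not strongly connected: some nonempty proper subset of `D` is closed
under predecessors in `D`. -/
def OTourObj.IsDecomposable (M : OTourObj) (D : Set M.carrier) : Prop :=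
  ∃ U ⊆ D, U.Nonempty ∧ U ≠ D ∧ ∀ u ∈ U, ∀ v ∈ D, M.rel v u → v ∈ U

/-- Preimages of the `3`-cycle are strongly connected. -/
theorem not_isDecomposable_preimage_cycle {C : OTourObj} {w : C.carrier → Fin 5}
    (hhom : ∀ c d, C.rel c d → cycleThenTwoRel (w c) (w d)) (hsurj : Function.Surjective w) :
    ¬ C.IsDecomposable {c | cutAt 2 (w c) = 0} := by
  rintro ⟨U, hUD, ⟨u, hu⟩, hne, hcl⟩
  have hstep : ∀ x y : Fin 5, x ≤ 2 → ¬ cycleThenTwoRel y x →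
      (∃ c ∈ U, w c = y) → ∀ c, w c = x → c ∈ U := by
    rintro x y hx hyx ⟨d, hd, rfl⟩ c rfl
    refine hcl d hd c (cutAt_eq_zero_iff.2 hx) ?_
    have hcd : c ≠ d := fun e => hyx (Or.inl (by rw [e]))
    exact (C.total c d hcd).resolve_right fun h => hyx (hhom _ _ h)
  have hex : ∀ x : Fin 5, (∀ c, w c = x → c ∈ U) → ∃ c ∈ U, w c = x := fun x h => by
    obtain ⟨c, hc⟩ := hsurj x
    exact ⟨c, h c hc, hc⟩
  have h01 := hstep 0 1 (by decide) (by decide)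
  have h12 := hstep 1 2 (by decide) (by decide)
  have h20 := hstep 2 0 (by decide) (by decide)
  have hcases : ∀ x : Fin 5, x ≤ 2 → x = 0 ∨ x = 1 ∨ x = 2 := by decide
  have hall : (∀ c, w c = 0 → c ∈ U) ∧ (∀ c, w c = 1 → c ∈ U) ∧ ∀ c, w c = 2 → c ∈ U := by
    rcases hcases _ (cutAt_eq_zero_iff.1 (hUD hu)) with h | h | h
    · have h2 := h20 ⟨u, hu, h⟩
      have h1 := h12 (hex _ h2)
      exact ⟨h01 (hex _ h1), h1, h2⟩
    · have h0 := h01 ⟨u, hu, h⟩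
      have h2 := h20 (hex _ h0)
      exact ⟨h0, h12 (hex _ h2), h2⟩
    · have h1 := h12 ⟨u, hu, h⟩
      have h0 := h01 (hex _ h1)
      exact ⟨h0, h1, h20 (hex _ h0)⟩
  refine hne (hUD.antisymm fun c hc => ?_)
  rcases hcases _ (cutAt_eq_zero_iff.1 hc) with h | h | h
  exacts [hall.1 c h, hall.2.1 c h, hall.2.2 c h]

/-- Preimages of the `3`-cycle together with the vertex it dominates are not strongly connected. -/
theorem isDecomposable_preimage_cycle_and_sink {C : OTourObj} {w : C.carrier → Fin 5}
    (hhom : ∀ c d, C.rel c d → cycleThenTwoRel (w c) (w d)) (hsurj : Function.Surjective w) :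
    C.IsDecomposable {c | cutAt 3 (w c) = 0} := by
  obtain ⟨a, ha⟩ := hsurj 0
  obtain ⟨b, hb⟩ := hsurj 3
  refine ⟨{c | w c ≤ 2}, fun c hc => cutAt_eq_zero_iff.2 (le_trans hc (by decide)),
    ⟨a, show w a ≤ 2 by rw [ha]; decide⟩, fun h => ?_, fun u hu v _ hvu => ?_⟩
  · have hmem : b ∈ {c | w c ≤ 2} := h ▸ cutAt_eq_zero_iff.2 hb.le
    have hle : w b ≤ 2 := hmem
    rw [hb] at hle
    exact absurd hle (by decide)
  · have key : ∀ x y : Fin 5, y ≤ 2 → cycleThenTwoRel x y → x ≤ 2 := by decide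
    exact key _ _ hu (hhom _ _ hvu)

/-- Theorem 7.2. The category `T` of finite linearly ordered
reflexive tournaments and rigid surjective homomorphisms does not have the dual
Ramsey property. -/
theorem stmt19 :
    ¬ HasDualRamseyClass (fun M : OTourObj => M.carrier) IsRSHtour := by
  intro H
  obtain ⟨C, -, hC⟩ := H 2 le_rfl twoChain trivial cycleThenTwo trivial
    ⟨cutAt 2, isRSHtour_cutAt (by decide) (by decide)⟩
  obtain ⟨w, hw, i, hi⟩ := hC fun f =>
    if C.IsDecomposable {c | f c = (0 : Fin 2)} then 0 else 1
  have h₂ := hi (cutAt 2) (isRSHtour_cutAt (by decide) (by decide))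
  have h₃ := hi (cutAt 3) (isRSHtour_cutAt (by decide) (by decide))
  replace h₂ := (if_neg (not_isDecomposable_preimage_cycle hw.1 hw.2.1)).symm.trans h₂
  replace h₃ := (if_pos (isDecomposable_preimage_cycle_and_sink hw.1 hw.2.1)).symm.trans h₃
  exact absurd (h₂.trans h₃.symm) (by decide)
end
end
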